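/- Every copy of Z₂ in Z₂ is complemented: let T be a linear map on pairs of real sequences that is bounded on Z₂ and bounded below on Z₂ (there is c > 0 with ‖Tu‖_{Z₂} ≥ c‖u‖_{Z₂} for all u ∈ Z₂), so that T is an isomorphism of Z₂ onto its range. Then the range of T is complemented in Z₂: there exists a linear map P on pairs of real sequences that is bounded on Z₂, satisfies P(Pu) = Pu for all u ∈ Z₂, and whose range on Z₂ equals the range of T, i.e., {Pu : u ∈ Z₂} = {Tu : u ∈ Z₂}. -/

import Mathlib

open scoped BigOperators

noncomputable section

/-- Real sequences. -/
abbrev RSeq : Type := ℕ → ℝ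

/-- Membership in ℓ². -/
def memL2 (x : RSeq) : Prop := Summable (fun n => (x n) ^ 2)

/-- The ℓ² norm. -/
noncomputable def l2norm (x : RSeq) : ℝ := Real.sqrt (∑' n, (x n) ^ 2)

/-- The Kalton–Peck map, defined coordinatewise.  (In Lean, `Real.log 0 = 0` and
division by zero is zero, so the conventions `0·log 0 = 0` and `KP 0 = 0` hold.) -/
noncomputable def KP (x : RSeq) : RSeq := fun n => 2 * x n * Real.log (|x n| / l2norm x)

/-- Membership in the Kalton–Peck space Z₂. -/
def memZ2 (u : RSeq × RSeq) : Prop := memL2 u.2 ∧ memL2 (u.1 - KP u.2)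

/-- The Z₂ quasinorm. -/
noncomputable def Z2norm (u : RSeq × RSeq) : ℝ := l2norm (u.1 - KP u.2) + l2norm u.2

/-- A map on pairs of sequences is bounded on Z₂. -/
def BoundedOnZ2 (T : RSeq × RSeq → RSeq × RSeq) : Prop :=
  (∀ u, memZ2 u → memZ2 (T u)) ∧ ∃ C : ℝ, ∀ u, memZ2 u → Z2norm (T u) ≤ C * Z2norm u

/-- The matrix operator associated to four linear maps on sequences. -/
def matOp (α β δ γ : RSeq →ₗ[ℝ] RSeq) : RSeq × RSeq → RSeq × RSeq :=
  fun u => (α u.1 + β u.2, δ u.1 + γ u.2)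

/-- Membership in the Orlicz space ℓ_f = Dom KP. -/
def memLf (x : RSeq) : Prop := memL2 x ∧ memL2 (KP x)

/-- The ℓ_f quasinorm. -/
noncomputable def lfNorm (x : RSeq) : ℝ := l2norm (KP x) + l2norm x

/-- Membership in ℓ_f* = Ran KP. -/
def memLfStar (ω : RSeq) : Prop := ∃ x : RSeq, memL2 x ∧ memL2 (ω - KP x)

/-- The ℓ_f* quasinorm. -/
noncomputable def lfStarNorm (ω : RSeq) : ℝ :=
  sInf {r : ℝ | ∃ x : RSeq, memL2 x ∧ memL2 (ω - KP x) ∧ r = l2norm (ω - KP x) + l2norm x}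

/-- A bounded map on Z₂ is strictly singular if every linear subspace of Z₂ on which it is
bounded below is finite dimensional. -/
def StrictlySingular (T : RSeq × RSeq → RSeq × RSeq) : Prop :=
  ∀ V : Submodule ℝ (RSeq × RSeq), (∀ v ∈ V, memZ2 v) →
    (∃ c > 0, ∀ v ∈ V, c * Z2norm v ≤ Z2norm (T v)) → FiniteDimensional ℝ V

/-- A set of sequences is totally bounded (relatively compact) for the ℓ² norm. -/
def l2TotallyBounded (A : Set RSeq) : Prop :=
  ∀ ε > 0, ∃ S : Set RSeq, S.Finite ∧
    ∀ a ∈ A, ∃ s ∈ S, memL2 (a - s) ∧ l2norm (a - s) < ε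

/-- A map on Z₂ is compact if the image of the unit ball is totally bounded for the
Z₂ quasinorm. -/
def CompactOnZ2 (T : RSeq × RSeq → RSeq × RSeq) : Prop :=
  ∀ ε > 0, ∃ S : Set (RSeq × RSeq), S.Finite ∧
    ∀ u, memZ2 u → Z2norm u ≤ 1 → ∃ s ∈ S, memZ2 (T u - s) ∧ Z2norm (T u - s) < ε

namespace KPZ
open Set Filter Topology

def toL (x : RSeq) (hx : memL2 x) : lp (fun _ : ℕ => ℝ) 2 :=
  ⟨x, by
    apply memℓp_gen
    simpa [memL2] using hx⟩

lemma toL_apply (x : RSeq) (hx : memL2 x) (n : ℕ) : toL x hx n = x n := rfl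

lemma norm_toL (x : RSeq) (hx : memL2 x) : ‖toL x hx‖ = l2norm x := by
  have h := lp.inner_eq_tsum (𝕜 := ℝ) (toL x hx) (toL x hx)
  rw [real_inner_self_eq_norm_sq] at h
  unfold l2norm
  rw [← Real.sqrt_sq (norm_nonneg (toL x hx)), h]
  congr 1
  apply tsum_congr
  intro n
  simp [toL_apply, sq]

lemma l2norm_nonneg (x : RSeq) : 0 ≤ l2norm x := Real.sqrt_nonneg _

lemma l2norm_sq (x : RSeq) : l2norm x ^ 2 = ∑' n, (x n) ^ 2 :=
  Real.sq_sqrt (tsum_nonneg fun _ => sq_nonneg _)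

lemma _root_.memL2.add {x y : RSeq} (hx : memL2 x) (hy : memL2 y) : memL2 (x + y) := by
  have := lp.memℓp (toL x hx + toL y hy)
  have := (memℓp_gen_iff (by norm_num)).1 this
  simpa [memL2, toL_apply] using this

lemma _root_.memL2.smul {x : RSeq} (c : ℝ) (hx : memL2 x) : memL2 (c • x) := by
  unfold memL2 at *
  have := hx.mul_left (c ^ 2)
  refine this.congr fun n => ?_
  simp [mul_pow]

lemma _root_.memL2.neg {x : RSeq} (hx : memL2 x) : memL2 (-x) := by
  simpa using hx.smul (-1)

lemma _root_.memL2.sub {x y : RSeq} (hx : memL2 x) (hy : memL2 y) : memL2 (x - y) := by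
  rw [sub_eq_add_neg]; exact hx.add hy.neg

lemma memL2_zero : memL2 0 := by
  unfold memL2; simp

lemma l2norm_zero : l2norm 0 = 0 := by simp [l2norm]

lemma l2norm_add_le {x y : RSeq} (hx : memL2 x) (hy : memL2 y) :
    l2norm (x + y) ≤ l2norm x + l2norm y := by
  rw [← norm_toL x hx, ← norm_toL y hy, ← norm_toL (x + y) (hx.add hy)]
  exact norm_add_le (toL x hx) (toL y hy)

lemma l2norm_smul (c : ℝ) (x : RSeq) : l2norm (c • x) = |c| * l2norm x := by
  unfold l2norm
  rw [← Real.sqrt_sq_eq_abs, ← Real.sqrt_mul (sq_nonneg c), ← tsum_mul_left]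
  simp [mul_pow]

lemma l2norm_neg (x : RSeq) : l2norm (-x) = l2norm x := by
  have := l2norm_smul (-1) x
  simpa using this

lemma cs_summable {x y : RSeq} (hx : memL2 x) (hy : memL2 y) :
    Summable (fun n => x n * y n) := by
  have := lp.summable_inner (𝕜 := ℝ) (toL x hx) (toL y hy)
  refine this.congr fun n => ?_
  simp [toL_apply, mul_comm]

lemma cs_le {x y : RSeq} (hx : memL2 x) (hy : memL2 y) :
    |∑' n, x n * y n| ≤ l2norm x * l2norm y := by
  have h := lp.inner_eq_tsum (𝕜 := ℝ) (toL x hx) (toL y hy)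
  rw [← norm_toL x hx, ← norm_toL y hy]
  have h2 := abs_real_inner_le_norm (toL x hx) (toL y hy)
  rw [h] at h2
  have e : ∑' n, x n * y n = ∑' i, inner ℝ (toL x hx i) (toL y hy i) := by
    apply tsum_congr
    intro n
    simp [toL_apply, mul_comm]
  rw [e]
  exact h2

lemma l2norm_eq_zero {x : RSeq} (hx : memL2 x) (h : l2norm x = 0) : x = 0 := by
  rw [← norm_toL x hx, norm_eq_zero] at h
  funext n
  have := congrArg (fun f : lp (fun _ : ℕ => ℝ) 2 => f n) h
  simpa [toL_apply] using this

lemma abs_le_l2norm {x : RSeq} (hx : memL2 x) (n : ℕ) : |x n| ≤ l2norm x := by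
  rw [← norm_toL x hx]
  exact lp.norm_apply_le_norm (by norm_num) (toL x hx) n

/-- finitely supported -/
def fin0 (x : RSeq) : Prop := ∃ N, ∀ n, N ≤ n → x n = 0

lemma fin0.summable {x : RSeq} (h : fin0 x) : Summable x := by
  obtain ⟨N, hN⟩ := h
  apply summable_of_ne_finset_zero (s := Finset.range N)
  intro b hb
  exact hN b (by simpa using hb)

lemma fin0.memL2 {x : RSeq} (h : fin0 x) : memL2 x := by
  obtain ⟨N, hN⟩ := h
  exact fin0.summable ⟨N, fun n hn => by simp [hN n hn]⟩

lemma fin0.KP {x : RSeq} (h : fin0 x) : fin0 (KP x) := by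
  obtain ⟨N, hN⟩ := h
  exact ⟨N, fun n hn => by simp [_root_.KP, hN n hn]⟩

/-- Converse Cauchy-Schwarz on finitely supported sequences -/
lemma memL2_of_test {x : RSeq} {C : ℝ} (hC : 0 ≤ C)
    (h : ∀ y : RSeq, fin0 y → |∑' n, x n * y n| ≤ C * l2norm y) :
    memL2 x ∧ l2norm x ≤ C := by
  have key : ∀ s : Finset ℕ, ∑ n ∈ s, (x n) ^ 2 ≤ C ^ 2 := by
    intro s
    let y : RSeq := fun n => if n ∈ s then x n else 0
    have hy : fin0 y := by
      obtain ⟨N, hN⟩ := s.exists_nat_subset_range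
      refine ⟨N, fun n hn => ?_⟩
      have : n ∉ s := fun hh => by
        have := hN hh
        simp at this; omega
      simp [y, this]
    have e1 : ∑' n, x n * y n = ∑ n ∈ s, (x n) ^ 2 := by
      rw [tsum_eq_sum (s := s)]
      · apply Finset.sum_congr rfl
        intro n hn; simp [y, hn, sq]
      · intro n hn; simp [y, hn]
    have e2 : l2norm y ^ 2 = ∑ n ∈ s, (x n) ^ 2 := by
      rw [l2norm_sq, tsum_eq_sum (s := s)]
      · apply Finset.sum_congr rfl
        intro n hn; simp [y, hn]
      · intro n hn; simp [y, hn]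
    have h1 := h y hy
    rw [e1, ← e2, abs_of_nonneg (sq_nonneg _)] at h1
    rw [← e2]
    have h0 := l2norm_nonneg y
    have : l2norm y ≤ C := by
      by_contra hh
      push Not at hh
      nlinarith
    nlinarith
  have hs : memL2 x := summable_of_sum_le (fun n => sq_nonneg _) key
  refine ⟨hs, ?_⟩
  apply Real.sqrt_le_iff.2
  exact ⟨hC, hs.tsum_le_of_sum_le key⟩

/-! ### KP -/

lemma KP_zero : KP 0 = 0 := by funext n; simp [KP]

lemma KP_smul (c : ℝ) (x : RSeq) : KP (c • x) = c • KP x := by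
  funext n
  by_cases hc : c = 0
  · simp [KP, hc]
  · simp only [KP, l2norm_smul, Pi.smul_apply, smul_eq_mul, abs_mul]
    rw [mul_div_mul_left _ _ (abs_ne_zero.2 hc)]
    ring

lemma KP_neg (x : RSeq) : KP (-x) = - KP x := by
  simpa using KP_smul (-1) x

lemma st_log {s t : ℝ} (hs : 0 < s) (ht : 0 < t) :
    |s * t * (Real.log s - Real.log t)| ≤ s ^ 2 + t ^ 2 := by
  have aux : ∀ {a b : ℝ}, 0 < a → 0 < b → a * b * (Real.log a - Real.log b) ≤ a ^ 2 := by
    intro a b ha hb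
    rw [← Real.log_div ha.ne' hb.ne']
    have := Real.log_le_sub_one_of_pos (div_pos ha hb)
    calc a * b * Real.log (a / b) ≤ a * b * (a / b) := by
          apply mul_le_mul_of_nonneg_left (by linarith) (by positivity)
      _ = a ^ 2 := by field_simp
  rw [abs_le]
  constructor
  · nlinarith [aux ht hs, sq_nonneg s]
  · nlinarith [aux hs ht, sq_nonneg t]

lemma core_pt {x y : RSeq} (hx : memL2 x) (hy : memL2 y) (n : ℕ) :
    |KP x n * y n - x n * KP y n| ≤
      2 * (l2norm y / l2norm x * (x n) ^ 2 + l2norm x / l2norm y * (y n) ^ 2) := by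
  have X0 := l2norm_nonneg x
  have Y0 := l2norm_nonneg y
  by_cases ha : x n = 0
  · simp [KP, ha]; positivity
  by_cases hb : y n = 0
  · simp [KP, hb]; positivity
  have X : 0 < l2norm x := lt_of_lt_of_le (abs_pos.2 ha) (abs_le_l2norm hx n)
  have Y : 0 < l2norm y := lt_of_lt_of_le (abs_pos.2 hb) (abs_le_l2norm hy n)
  have h := st_log (div_pos (abs_pos.2 ha) X) (div_pos (abs_pos.2 hb) Y)
  have e : KP x n * y n - x n * KP y n =
    2 * (x n * y n) * (Real.log (|x n| / l2norm x) - Real.log (|y n| / l2norm y)) := by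
    simp only [KP]; ring
  rw [e, abs_mul, abs_mul, abs_mul]
  rw [abs_mul, abs_mul, abs_div, abs_div, abs_abs, abs_abs, abs_of_pos X, abs_of_pos Y] at h
  set D := |Real.log (|x n| / l2norm x) - Real.log (|y n| / l2norm y)|
  rw [div_pow, div_pow, sq_abs, sq_abs] at h
  have h2 := mul_le_mul_of_nonneg_left h (by positivity : 0 ≤ 2 * (l2norm x * l2norm y))
  calc |2| * (|x n| * |y n|) * D
      = 2 * (l2norm x * l2norm y) * (|x n| / l2norm x * (|y n| / l2norm y) * D) := by
        rw [abs_of_pos (by norm_num : (0:ℝ) < 2)]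
        field_simp
    _ ≤ _ := h2
    _ = _ := by field_simp

lemma core_summable {x y : RSeq} (hx : memL2 x) (hy : memL2 y) :
    Summable (fun n => KP x n * y n - x n * KP y n) := by
  apply Summable.of_norm_bounded
    (((hx.mul_left (l2norm y / l2norm x)).add (hy.mul_left (l2norm x / l2norm y))).mul_left 2)
  intro n
  exact core_pt hx hy n

lemma core_le {x y : RSeq} (hx : memL2 x) (hy : memL2 y) :
    |∑' n, (KP x n * y n - x n * KP y n)| ≤ 4 * (l2norm x * l2norm y) := by
  have hsum := ((hx.mul_left (l2norm y / l2norm x)).add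
    (hy.mul_left (l2norm x / l2norm y))).mul_left 2
  have h1 := tsum_of_norm_bounded (f := fun n => KP x n * y n - x n * KP y n) hsum.hasSum
    (fun n => core_pt hx hy n)
  refine h1.trans ?_
  rw [tsum_mul_left, (hx.mul_left _).tsum_add (hy.mul_left _), tsum_mul_left, tsum_mul_left,
    ← l2norm_sq, ← l2norm_sq]
  have X0 := l2norm_nonneg x
  have Y0 := l2norm_nonneg y
  rcases X0.eq_or_lt with h | h
  · rw [← h]; simp
  rcases Y0.eq_or_lt with h' | h'
  · rw [← h']; simp
  apply le_of_eq
  field_simp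
  ring

/-! ### symplectic form on pairs -/

def Om (u v : RSeq × RSeq) : ℝ := ∑' n, (u.1 n * v.2 n - u.2 n * v.1 n)

lemma Om_split (u v : RSeq × RSeq) (n : ℕ) : u.1 n * v.2 n - u.2 n * v.1 n =
    ((u.1 - KP u.2) n * v.2 n - u.2 n * (v.1 - KP v.2) n) +
     (KP u.2 n * v.2 n - u.2 n * KP v.2 n) := by
  simp; ring

lemma Om_summable {u v : RSeq × RSeq} (hu : memZ2 u) (hv : memZ2 v) :
    Summable (fun n => u.1 n * v.2 n - u.2 n * v.1 n) := by
  simp_rw [Om_split]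
  exact ((cs_summable hu.2 hv.1).sub (cs_summable hu.1 hv.2)).add (core_summable hu.1 hv.1)

lemma Om_le {u v : RSeq × RSeq} (hu : memZ2 u) (hv : memZ2 v) :
    |Om u v| ≤ 4 * (Z2norm u * Z2norm v) := by
  unfold Om
  simp_rw [Om_split]
  rw [((cs_summable hu.2 hv.1).sub (cs_summable hu.1 hv.2)).tsum_add (core_summable hu.1 hv.1),
    (cs_summable hu.2 hv.1).tsum_sub (cs_summable hu.1 hv.2)]
  have h1 := abs_le.1 (cs_le hu.2 hv.1)
  have h2 := abs_le.1 (cs_le hu.1 hv.2)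
  have h3 := abs_le.1 (core_le hu.1 hv.1)
  unfold Z2norm
  have a1 := l2norm_nonneg (u.1 - KP u.2)
  have a2 := l2norm_nonneg u.2
  have a3 := l2norm_nonneg (v.1 - KP v.2)
  have a4 := l2norm_nonneg v.2
  have := mul_nonneg a1 a3
  have := mul_nonneg a1 a4
  have := mul_nonneg a2 a3
  have := mul_nonneg a2 a4
  rw [abs_le]
  constructor <;> nlinarith

lemma memZ2_of_test {u : RSeq × RSeq} {C : ℝ} (hC : 0 ≤ C)
    (h1 : ∀ y : RSeq, fin0 y → |Om u (y, 0)| ≤ C * l2norm y)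
    (h2 : ∀ y : RSeq, fin0 y → |Om u (KP y, y)| ≤ C * l2norm y) :
    memZ2 u ∧ Z2norm u ≤ 6 * C := by
  have hx := memL2_of_test (x := u.2) hC (fun y hy => by
    have := h1 y hy
    simpa [Om, tsum_neg] using this)
  have hh := memL2_of_test (x := u.1 - KP u.2) (C := 5 * C) (by positivity) (fun y hy => by
    have a := abs_le.1 (h2 y hy)
    have b := abs_le.1 (core_le hx.1 hy.memL2)
    have e : ∑' n, (u.1 - KP u.2) n * y n =
        Om u (KP y, y) - ∑' n, (KP u.2 n * y n - u.2 n * KP y n) := by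
      unfold Om
      obtain ⟨N, hN⟩ := hy
      rw [← Summable.tsum_sub]
      · apply tsum_congr; intro n; simp; ring
      · apply fin0.summable
        exact ⟨N, fun n hn => by simp [KP, hN n hn]⟩
      · apply fin0.summable
        exact ⟨N, fun n hn => by simp [KP, hN n hn]⟩
    rw [e]
    have c := l2norm_nonneg y
    have d : l2norm u.2 * l2norm y ≤ C * l2norm y := mul_le_mul_of_nonneg_right hx.2 c
    rw [abs_le]
    constructor <;> linarith)
  refine ⟨⟨hx.1, hh.1⟩, ?_⟩
  unfold Z2norm
  linarith [hx.2, hh.2]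


lemma memZ2_j {y : RSeq} (hy : memL2 y) : memZ2 (y, 0) := by
  refine ⟨memL2_zero, ?_⟩
  simpa [KP_zero] using hy

lemma Z2norm_j (y : RSeq) : Z2norm (y, 0) = l2norm y := by
  simp [Z2norm, KP_zero, l2norm_zero]

lemma memZ2_k {y : RSeq} (hy : memL2 y) : memZ2 (KP y, y) := by
  refine ⟨hy, ?_⟩
  simpa using memL2_zero

lemma Z2norm_k (y : RSeq) : Z2norm (KP y, y) = l2norm y := by
  simp [Z2norm, l2norm_zero]

lemma Z2norm_nonneg (u : RSeq × RSeq) : 0 ≤ Z2norm u :=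
  add_nonneg (l2norm_nonneg _) (l2norm_nonneg _)

lemma Z2norm_smul (c : ℝ) (u : RSeq × RSeq) : Z2norm (c • u) = |c| * Z2norm u := by
  simp only [Z2norm, Prod.smul_fst, Prod.smul_snd, KP_smul, ← smul_sub, l2norm_smul]
  ring

lemma memZ2_smul (c : ℝ) {u : RSeq × RSeq} (hu : memZ2 u) : memZ2 (c • u) := by
  refine ⟨hu.1.smul c, ?_⟩
  simp only [Prod.smul_fst, Prod.smul_snd, KP_smul, ← smul_sub]
  exact hu.2.smul c

lemma Om_antisymm (u v : RSeq × RSeq) : Om u v = - Om v u := by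
  unfold Om
  rw [← tsum_neg]
  apply tsum_congr; intro n; ring

lemma Om_add_left {u v w : RSeq × RSeq} (hu : memZ2 u) (hv : memZ2 v) (hw : memZ2 w) :
    Om (u + v) w = Om u w + Om v w := by
  unfold Om
  rw [← (Om_summable hu hw).tsum_add (Om_summable hv hw)]
  apply tsum_congr; intro n; simp; ring

lemma Om_smul_left (c : ℝ) (u v : RSeq × RSeq) : Om (c • u) v = c * Om u v := by
  unfold Om
  rw [← tsum_mul_left]
  apply tsum_congr; intro n; simp; ring

lemma memZ2_add {u v : RSeq × RSeq} (hu : memZ2 u) (hv : memZ2 v) : memZ2 (u + v) := by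
  have nu := Z2norm_nonneg u
  have nv := Z2norm_nonneg v
  refine (memZ2_of_test (C := 4 * (Z2norm u + Z2norm v)) (by positivity) ?_ ?_).1
  · intro y hy
    have hy' := memZ2_j hy.memL2
    rw [Om_add_left hu hv hy']
    have a := Om_le hu hy'
    have b := Om_le hv hy'
    rw [Z2norm_j] at a b
    have := abs_add_le (Om u (y, 0)) (Om v (y, 0))
    linarith
  · intro y hy
    have hy' := memZ2_k hy.memL2
    rw [Om_add_left hu hv hy']
    have a := Om_le hu hy'
    have b := Om_le hv hy'
    rw [Z2norm_k] at a b
    have := abs_add_le (Om u (KP y, y)) (Om v (KP y, y))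
    linarith

def Zsub : Submodule ℝ (RSeq × RSeq) where
  carrier := {u | memZ2 u}
  add_mem' := memZ2_add
  zero_mem' := memZ2_j memL2_zero
  smul_mem' := fun c _ hu => memZ2_smul c hu

/-- The Kalton–Peck space as a type. -/
def Z : Type := Zsub

instance : AddCommGroup Z := inferInstanceAs (AddCommGroup Zsub)
instance : Module ℝ Z := inferInstanceAs (Module ℝ Zsub)

/-- underlying pair -/
def vl : Z →ₗ[ℝ] RSeq × RSeq := Zsub.subtype

def mk (u : RSeq × RSeq) (h : memZ2 u) : Z := ⟨u, h⟩

lemma vl_mk (u : RSeq × RSeq) (h : memZ2 u) : vl (mk u h) = u := rfl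

lemma vl_mem (u : Z) : memZ2 (vl u) := u.2

lemma vl_inj {u v : Z} (h : vl u = vl v) : u = v := Subtype.ext h

/-- quasinorm -/
def zn (u : Z) : ℝ := Z2norm (vl u)

lemma zn_nonneg (u : Z) : 0 ≤ zn u := Z2norm_nonneg _

lemma zn_smul (c : ℝ) (u : Z) : zn (c • u) = |c| * zn u := by
  simp [zn, Z2norm_smul]

/-- symplectic form -/
def om (u v : Z) : ℝ := Om (vl u) (vl v)

lemma om_le (u v : Z) : |om u v| ≤ 4 * (zn u * zn v) := Om_le (vl_mem u) (vl_mem v)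

lemma om_antisymm (u v : Z) : om u v = - om v u := Om_antisymm _ _

lemma om_add_left (u v w : Z) : om (u + v) w = om u w + om v w := by
  simpa [om] using Om_add_left (vl_mem u) (vl_mem v) (vl_mem w)

lemma om_smul_left (c : ℝ) (u v : Z) : om (c • u) v = c * om u v := by
  simpa [om] using Om_smul_left c (vl u) (vl v)

lemma om_add_right (u v w : Z) : om u (v + w) = om u v + om u w := by
  rw [om_antisymm, om_add_left, om_antisymm u v, om_antisymm u w]; ring

lemma om_smul_right (c : ℝ) (u v : Z) : om u (c • v) = c * om u v := by
  rw [om_antisymm, om_smul_left, om_antisymm u v]; ring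

abbrev UB : Type := {v : Z // zn v ≤ 1}

lemma zn_zero : zn 0 = 0 := by
  have := zn_smul 0 0
  simpa using this

instance : Nonempty UB := ⟨⟨0, by rw [zn_zero]; norm_num⟩⟩

instance : Norm Z := ⟨fun u => ⨆ v : UB, |om u v.1|⟩

lemma norm_def (u : Z) : ‖u‖ = ⨆ v : UB, |om u v.1| := rfl

lemma bdd (u : Z) : BddAbove (range fun v : UB => |om u v.1|) := by
  refine ⟨4 * zn u, ?_⟩
  rintro _ ⟨v, rfl⟩
  have := om_le u v.1
  have h := v.2
  have := zn_nonneg u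
  have := zn_nonneg v.1
  show |om u v.1| ≤ _
  nlinarith

lemma norm_le_zn (u : Z) : ‖u‖ ≤ 4 * zn u := by
  apply ciSup_le
  intro v
  have := om_le u v.1
  have h := v.2
  have := zn_nonneg u
  have := zn_nonneg v.1
  nlinarith

lemma nrm_nonneg (u : Z) : 0 ≤ ‖u‖ := Real.iSup_nonneg fun _ => abs_nonneg _

lemma om_le_norm (u v : Z) : |om u v| ≤ ‖u‖ * zn v := by
  rcases (zn_nonneg v).eq_or_lt with h | h
  · have := om_le u v
    rw [← h] at this ⊢
    simpa using this
  · have h1 : zn ((zn v)⁻¹ • v) ≤ 1 := by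
      rw [zn_smul, abs_of_pos (inv_pos.2 h), inv_mul_cancel₀ h.ne']
    have h2 := le_ciSup (bdd u) ⟨(zn v)⁻¹ • v, h1⟩
    simp only [om_smul_right, abs_mul, abs_of_pos (inv_pos.2 h)] at h2
    rw [← norm_def] at h2
    rw [inv_mul_le_iff₀ h] at h2
    linarith

/-- inclusion and lifting -/
def jj (x : RSeq) (h : memL2 x) : Z := mk (x, 0) (memZ2_j h)
def kk (x : RSeq) (h : memL2 x) : Z := mk (KP x, x) (memZ2_k h)

lemma zn_jj (x : RSeq) (h : memL2 x) : zn (jj x h) = l2norm x := Z2norm_j x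
lemma zn_kk (x : RSeq) (h : memL2 x) : zn (kk x h) = l2norm x := Z2norm_k x

lemma zn_le_norm (u : Z) : zn u ≤ 6 * ‖u‖ := by
  refine (memZ2_of_test (u := vl u) (nrm_nonneg u) ?_ ?_).2
  · intro y hy
    have := om_le_norm u (jj y hy.memL2)
    rwa [zn_jj] at this
  · intro y hy
    have := om_le_norm u (kk y hy.memL2)
    rwa [zn_kk] at this

lemma zn_eq_zero {u : Z} (h : zn u = 0) : u = 0 := by
  apply vl_inj
  have h1 := l2norm_nonneg ((vl u).1 - KP (vl u).2)
  have h2 := l2norm_nonneg (vl u).2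
  unfold zn Z2norm at h
  have e2 := l2norm_eq_zero (vl_mem u).1 (by linarith)
  have e1 := l2norm_eq_zero (vl_mem u).2 (by linarith)
  rw [e2, KP_zero, sub_zero] at e1
  rw [map_zero]
  exact Prod.ext e1 e2

instance : NormedAddCommGroup Z := NormedAddCommGroup.ofCore (𝕜 := ℝ)
  { norm_nonneg := nrm_nonneg
    norm_smul := by
      intro c u
      rw [norm_def, norm_def, Real.norm_eq_abs, Real.mul_iSup_of_nonneg (abs_nonneg c)]
      simp_rw [om_smul_left, abs_mul]
    norm_triangle := by
      intro u v
      rw [norm_def (u + v)]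
      apply ciSup_le
      intro w
      rw [om_add_left]
      have a := le_ciSup (bdd u) w
      have b := le_ciSup (bdd v) w
      rw [← norm_def] at a b
      exact (abs_add_le _ _).trans (add_le_add a b)
    norm_eq_zero_iff := by
      intro u
      constructor
      · intro h
        apply zn_eq_zero
        have := zn_le_norm u
        have := zn_nonneg u
        linarith
      · rintro rfl
        have := norm_le_zn 0
        rw [zn_zero] at this
        have := nrm_nonneg 0
        linarith }

instance : NormedSpace ℝ Z where
  norm_smul_le := by
    intro c u
    rw [norm_def, norm_def, Real.norm_eq_abs, Real.mul_iSup_of_nonneg (abs_nonneg c)]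
    simp_rw [om_smul_left, abs_mul]
    exact le_rfl

lemma om_norm (u v : Z) : |om u v| ≤ 6 * ‖u‖ * ‖v‖ := by
  have := om_le_norm u v
  have := zn_le_norm v
  have := norm_nonneg u
  nlinarith

def OM : Z →L[ℝ] Z →L[ℝ] ℝ :=
  LinearMap.mkContinuous₂
    (LinearMap.mk₂ ℝ om om_add_left om_smul_left om_add_right om_smul_right) 6
    (fun u v => om_norm u v)

lemma OM_apply (u v : Z) : OM u v = om u v := rfl

/-- make continuous operators from zn-bounds -/
def mkZ (f : Z →ₗ[ℝ] Z) (C : ℝ) (h : ∀ u, zn (f u) ≤ C * zn u) : Z →L[ℝ] Z :=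
  f.mkContinuous (24 * |C|) (by
    intro u
    have a := norm_le_zn (f u)
    have b := zn_le_norm u
    have c := h u
    have d := zn_nonneg u
    have e : C * zn u ≤ |C| * zn u := mul_le_mul_of_nonneg_right (le_abs_self C) d
    have f := mul_le_mul_of_nonneg_left b (abs_nonneg C)
    nlinarith)

lemma mkZ_apply (f : Z →ₗ[ℝ] Z) (C : ℝ) (h : ∀ u, zn (f u) ≤ C * zn u) (u : Z) :
    mkZ f C h u = f u := rfl

/-! ### cuts -/

open Classical in
lemma memL2_ind (A : Set ℕ) {x : RSeq} (hx : memL2 x) : memL2 (A.indicator x) := by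
  refine Summable.of_nonneg_of_le (fun n => sq_nonneg _) (fun n => ?_) hx
  by_cases h : n ∈ A
  · simp [h]
  · simp [h, sq_nonneg]

lemma l2norm_ind_le (A : Set ℕ) {x : RSeq} (hx : memL2 x) :
    l2norm (A.indicator x) ≤ l2norm x := by
  apply Real.sqrt_le_sqrt
  refine (memL2_ind A hx).tsum_le_tsum (fun n => ?_) hx
  by_cases h : n ∈ A
  · simp [h]
  · simp [h, sq_nonneg]

def cutP (A : Set ℕ) : (RSeq × RSeq) →ₗ[ℝ] (RSeq × RSeq) where
  toFun u := (A.indicator u.1, A.indicator u.2)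
  map_add' u v := by
    ext n <;> by_cases h : n ∈ A <;> simp [h]
  map_smul' c u := by
    ext n <;> by_cases h : n ∈ A <;> simp [h]

lemma cut_KP (A : Set ℕ) {x : RSeq} (hx : memL2 x) :
    A.indicator (KP x) - KP (A.indicator x) =
      (2 * Real.log (l2norm (A.indicator x) / l2norm x)) • A.indicator x := by
  funext n
  by_cases h : n ∈ A
  · by_cases h0 : x n = 0
    · simp [h, KP, h0]
    · have hA := abs_le_l2norm (memL2_ind A hx) n
      simp only [indicator_of_mem h] at hA
      have p1 : 0 < |x n| := abs_pos.2 h0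
      have p2 : 0 < l2norm (A.indicator x) := by linarith
      have p3 := l2norm_ind_le A hx
      have p4 : 0 < l2norm x := by linarith
      simp only [Pi.sub_apply, indicator_of_mem h, KP, Pi.smul_apply, smul_eq_mul]
      rw [Real.log_div p1.ne' p4.ne', Real.log_div p1.ne' p2.ne', Real.log_div p2.ne' p4.ne']
      ring
  · simp [h, KP]

lemma cut_decomp (A : Set ℕ) {u : RSeq × RSeq} (hu : memZ2 u) :
    (cutP A u).1 - KP (cutP A u).2 = A.indicator (u.1 - KP u.2) +
      (2 * Real.log (l2norm (A.indicator u.2) / l2norm u.2)) • A.indicator u.2 := by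
  rw [← cut_KP A hu.1, indicator_sub']
  simp only [cutP, LinearMap.coe_mk, AddHom.coe_mk]
  abel

lemma cut_mem (A : Set ℕ) {u : RSeq × RSeq} (hu : memZ2 u) : memZ2 (cutP A u) := by
  refine ⟨memL2_ind A hu.1, ?_⟩
  rw [cut_decomp A hu]
  exact (memL2_ind A hu.2).add ((memL2_ind A hu.1).smul _)

lemma cut_norm (A : Set ℕ) {u : RSeq × RSeq} (hu : memZ2 u) :
    Z2norm (cutP A u) ≤ l2norm (A.indicator (u.1 - KP u.2)) +
      2 * l2norm u.2 * |(l2norm (A.indicator u.2) / l2norm u.2) *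
        Real.log (l2norm (A.indicator u.2) / l2norm u.2)| + l2norm (A.indicator u.2) := by
  unfold Z2norm
  rw [cut_decomp A hu]
  have h := l2norm_add_le (memL2_ind A hu.2) ((memL2_ind A hu.1).smul
    (2 * Real.log (l2norm (A.indicator u.2) / l2norm u.2)))
  rw [l2norm_smul] at h
  have e : |2 * Real.log (l2norm (A.indicator u.2) / l2norm u.2)| * l2norm (A.indicator u.2)
      = 2 * l2norm u.2 * |(l2norm (A.indicator u.2) / l2norm u.2) *
        Real.log (l2norm (A.indicator u.2) / l2norm u.2)| := by
    rcases (l2norm_nonneg u.2).eq_or_lt with h0 | h0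
    · rw [← h0]; simp
    · rw [abs_mul, abs_mul, abs_div, abs_of_pos h0, abs_of_nonneg (l2norm_nonneg _)]
      rw [abs_of_pos (by norm_num : (0:ℝ) < 2)]
      field_simp
  rw [e] at h
  have : l2norm (cutP A u).2 = l2norm (A.indicator u.2) := rfl
  rw [this]
  linarith

lemma xlogx {r R : ℝ} (h0 : 0 ≤ r) (h : r ≤ R) : |r / R * Real.log (r / R)| ≤ 1 := by
  rcases h0.eq_or_lt with h1 | h1
  · rw [← h1]; simp
  · have : 0 < R := by linarith
    have := Real.abs_log_mul_self_lt (r / R) (by positivity) (by rw [div_le_one this]; exact h)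
    rw [mul_comm]
    exact this.le

lemma cut_norm_le (A : Set ℕ) {u : RSeq × RSeq} (hu : memZ2 u) :
    Z2norm (cutP A u) ≤ 3 * Z2norm u := by
  have h := cut_norm A hu
  have h1 := l2norm_ind_le A hu.1
  have h2 := l2norm_ind_le A hu.2
  have h3 := xlogx (l2norm_nonneg (A.indicator u.2)) h1
  have h4 := l2norm_nonneg u.2
  have h5 := mul_le_mul_of_nonneg_left h3 (by positivity : 0 ≤ 2 * l2norm u.2)
  have h6 := l2norm_nonneg (u.1 - KP u.2)
  unfold Z2norm at *
  linarith

def cutL (A : Set ℕ) : Z →ₗ[ℝ] Z := (cutP A).restrict (p := Zsub) (q := Zsub)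
  (fun _ hu => cut_mem A hu)

def cut (A : Set ℕ) : Z →L[ℝ] Z := mkZ (cutL A) 3 (fun u => cut_norm_le A (vl_mem u))

lemma vl_cut (A : Set ℕ) (u : Z) :
    vl (cut A u) = (A.indicator (vl u).1, A.indicator (vl u).2) := rfl

lemma cut_opnorm (A : Set ℕ) (u : Z) : ‖cut A u‖ ≤ 72 * ‖u‖ := by
  have a := norm_le_zn (cut A u)
  have b := zn_le_norm u
  have c : zn (cut A u) ≤ 3 * zn u := cut_norm_le A (vl_mem u)
  linarith

lemma cut_cut (A B : Set ℕ) (u : Z) : cut A (cut B u) = cut (A ∩ B) u := by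
  apply vl_inj
  simp [vl_cut, indicator_indicator]

lemma cut_add_compl (A : Set ℕ) (u : Z) : cut A u + cut Aᶜ u = u := by
  apply vl_inj
  rw [map_add, vl_cut, vl_cut]
  ext n <;> simp [-Pi.add_apply, indicator_self_add_compl]

lemma om_cut (A : Set ℕ) (u v : Z) : om (cut A u) v = om u (cut A v) := by
  unfold om Om
  apply tsum_congr
  intro n
  rw [vl_cut, vl_cut]
  by_cases h : n ∈ A <;> simp [h]

lemma ind_tail {x : RSeq} (hx : memL2 x) :
    Tendsto (fun N : ℕ => l2norm ((Ici N).indicator x)) atTop (𝓝 0) := by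
  have h : ∀ N : ℕ, l2norm ((Ici N).indicator x) = Real.sqrt (∑' k, (x (k + N)) ^ 2) := by
    intro N
    unfold l2norm
    congr 1
    have := (memL2_ind (Ici N) hx).sum_add_tsum_nat_add N
    rw [← this, Finset.sum_eq_zero, zero_add]
    · apply tsum_congr; intro k
      rw [indicator_of_mem]; simp
    · intro i hi
      rw [indicator_of_notMem]
      · simp
      · simpa using hi
  simp_rw [h]
  have := tendsto_sum_nat_add (fun n => (x n) ^ 2)
  have := (Real.continuous_sqrt.tendsto 0).comp this
  simpa [Function.comp_def] using this

lemma cut_tail (u : Z) : Tendsto (fun N : ℕ => cut (Ici N) u) atTop (𝓝 0) := by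
  have hu := vl_mem u
  rw [tendsto_zero_iff_norm_tendsto_zero]
  have a1 := ind_tail hu.2
  have a2 := ind_tail hu.1
  have a3 : Tendsto (fun N : ℕ => l2norm ((Ici N).indicator (vl u).2) / l2norm (vl u).2) atTop
      (𝓝 0) := by simpa using a2.div_const (l2norm (vl u).2)
  have a4 := ((Real.continuous_mul_log.tendsto 0).comp a3).abs.const_mul (2 * l2norm (vl u).2)
  have a5 := ((a1.add a4).add a2).const_mul 4
  simp only [Real.log_zero, mul_zero, abs_zero, add_zero, Function.comp_def] at a5
  refine squeeze_zero (fun _ => norm_nonneg _) (fun N => ?_) a5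
  refine (norm_le_zn _).trans ?_
  exact mul_le_mul_of_nonneg_left (cut_norm (Ici N) hu) (by norm_num)

lemma cut_init (u : Z) : Tendsto (fun N : ℕ => cut (Iio N) u) atTop (𝓝 u) := by
  have h : ∀ N : ℕ, cut (Iio N) u = u - cut (Ici N) u := by
    intro N
    have := cut_add_compl (Iio N) u
    rw [compl_Iio] at this
    exact eq_sub_of_add_eq this
  simp_rw [h]
  simpa using (cut_tail u).const_sub u

/-! ### duality -/

def ee (n : ℕ) : RSeq := Pi.single n 1

lemma ee_fin0 (n : ℕ) : fin0 (ee n) :=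
  ⟨n + 1, fun k hk => by simp [ee, Pi.single_apply]; omega⟩

lemma KP_ee (n : ℕ) : KP (ee n) = 0 := by
  funext k
  have : l2norm (ee n) = 1 := by
    unfold l2norm
    rw [tsum_eq_single n]
    · simp [ee]
    · intro b hb; simp [ee, hb]
  by_cases h : k = n
  · simp only [KP, this]
    simp [ee, h]
  · simp [KP, ee, h]

def e1 (n : ℕ) : Z := jj (ee n) (ee_fin0 n).memL2
def e2 (n : ℕ) : Z := kk (ee n) (ee_fin0 n).memL2

lemma vl_e1 (n : ℕ) : vl (e1 n) = (ee n, 0) := rfl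
lemma vl_e2 (n : ℕ) : vl (e2 n) = (0, ee n) := by
  show (KP (ee n), ee n) = _
  rw [KP_ee]

lemma cut_eq_sum (N : ℕ) (u : Z) :
    cut (Iio N) u = ∑ n ∈ Finset.range N, ((vl u).1 n • e1 n + (vl u).2 n • e2 n) := by
  apply vl_inj
  rw [map_sum, vl_cut]
  simp only [map_add, map_smul, vl_e1, vl_e2]
  ext k
  · simp only [Prod.fst_sum, Prod.fst_add, Prod.smul_fst, Finset.sum_apply, Pi.add_apply,
      Pi.smul_apply, smul_eq_mul, ee, Pi.zero_apply, mul_zero, add_zero, Pi.single_apply]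
    by_cases h : k < N <;> simp [indicator, h]
  · simp only [Prod.snd_sum, Prod.snd_add, Prod.smul_snd, Finset.sum_apply, Pi.add_apply,
      Pi.smul_apply, smul_eq_mul, ee, Pi.zero_apply, mul_zero, zero_add, Pi.single_apply]
    by_cases h : k < N <;> simp [indicator, h]

lemma om_e2 (u : Z) (n : ℕ) : om u (e2 n) = (vl u).1 n := by
  unfold om Om
  rw [vl_e2, tsum_eq_single n]
  · simp [ee]
  · intro b hb; simp [ee, hb]

lemma om_e1 (u : Z) (n : ℕ) : om u (e1 n) = - (vl u).2 n := by
  unfold om Om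
  rw [vl_e1, tsum_eq_single n]
  · simp [ee]
  · intro b hb; simp [ee, hb]

lemma OM_surj (φ : Z →L[ℝ] ℝ) : ∃ v, OM v = φ := by
  let p : RSeq × RSeq := (fun n => φ (e2 n), fun n => - φ (e1 n))
  have key : ∀ w : Z, fin0 (vl w).1 → fin0 (vl w).2 → Om p (vl w) = φ w := by
    rintro w ⟨N1, h1⟩ ⟨N2, h2⟩
    set N := max N1 N2
    have hw : cut (Iio N) w = w := by
      apply vl_inj
      rw [vl_cut]
      ext k
      · by_cases h : k < N
        · simp [indicator, h]
        · simp [indicator, h, h1 k (by omega)]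
      · by_cases h : k < N
        · simp [indicator, h]
        · simp [indicator, h, h2 k (by omega)]
    conv_rhs => rw [← hw, cut_eq_sum]
    rw [map_sum]
    unfold Om
    rw [tsum_eq_sum (s := Finset.range N)]
    · apply Finset.sum_congr rfl
      intro n _
      simp [p]; ring
    · intro n hn
      simp only [Finset.mem_range, not_lt] at hn
      rw [h1 n (by omega), h2 n (by omega)]; simp
  have hp := memZ2_of_test (u := p) (C := 4 * ‖φ‖) (by positivity) (fun y hy => by
      have a := key (jj y hy.memL2) hy ⟨0, fun n _ => rfl⟩
      have b := φ.le_opNorm (jj y hy.memL2)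
      have c := norm_le_zn (jj y hy.memL2)
      rw [zn_jj] at c
      have d : Om p (y, 0) = φ (jj y hy.memL2) := a
      rw [d, ← Real.norm_eq_abs]
      have := mul_le_mul_of_nonneg_left c (norm_nonneg φ)
      linarith) (fun y hy => by
      have a := key (kk y hy.memL2) hy.KP hy
      have b := φ.le_opNorm (kk y hy.memL2)
      have c := norm_le_zn (kk y hy.memL2)
      rw [zn_kk] at c
      have d : Om p (KP y, y) = φ (kk y hy.memL2) := a
      rw [d, ← Real.norm_eq_abs]
      have := mul_le_mul_of_nonneg_left c (norm_nonneg φ)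
      linarith)
  refine ⟨mk p hp.1, ?_⟩
  ext w
  have t1 := ((OM (mk p hp.1)).continuous.tendsto w).comp (cut_init w)
  have t2 := (φ.continuous.tendsto w).comp (cut_init w)
  refine tendsto_nhds_unique t1 (t2.congr fun N => ?_)
  simp only [Function.comp_apply]
  refine (key _ ?_ ?_).symm
  · exact ⟨N, fun n hn => by simp [vl_cut, indicator, Nat.not_lt.2 hn]⟩
  · exact ⟨N, fun n hn => by simp [vl_cut, indicator, Nat.not_lt.2 hn]⟩

lemma OM_lower (u : Z) : ‖u‖ ≤ 4 * ‖OM u‖ := by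
  apply ciSup_le
  intro v
  have a := (OM u).le_opNorm v.1
  have b := norm_le_zn v.1
  have c := v.2
  have d := norm_nonneg (OM u)
  rw [OM_apply, Real.norm_eq_abs] at a
  nlinarith


section abstractpart

variable {E : Type*} [NormedAddCommGroup E] [NormedSpace ℝ E]

lemma closed_range_of_lower [CompleteSpace E] {F : Type*} [NormedAddCommGroup F]
    [NormedSpace ℝ F] (A : E →L[ℝ] F) {c : ℝ} (hc : 0 < c) (h : ∀ u, c * ‖u‖ ≤ ‖A u‖) :
    IsClosed (range A) ∧ Function.Injective A := by
  have hA : AntilipschitzWith (Real.toNNReal c⁻¹) A := by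
    apply AddMonoidHomClass.antilipschitz_of_bound
    intro x
    rw [Real.coe_toNNReal _ (inv_nonneg.2 hc.le), inv_mul_eq_div, le_div_iff₀ hc, mul_comm]
    exact h x
  exact ⟨hA.isClosed_range A.uniformContinuous, hA.injective⟩

lemma surj_of_lower [CompleteSpace E] (W : E →L[ℝ] E →L[ℝ] ℝ) (hanti : ∀ u v, W u v = - W v u)
    (hsurj : ∀ φ : E →L[ℝ] ℝ, ∃ v, W v = φ)
    (A : E →L[ℝ] E →L[ℝ] ℝ) (hA : ∀ u v, A u v = - A v u) {c : ℝ} (hc : 0 < c)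
    (h : ∀ u, c * ‖u‖ ≤ ‖A u‖) : Function.Surjective A := by
  obtain ⟨hcl, hinj⟩ := closed_range_of_lower A hc h
  by_contra hns
  rw [Function.Surjective] at hns
  push Not at hns
  obtain ⟨φ, hφ⟩ := hns
  have hconv : Convex ℝ (range A) := by
    have := (LinearMap.range (A : E →ₗ[ℝ] E →L[ℝ] ℝ)).convex
    exact this
  obtain ⟨f, s, hf1, hf2⟩ := geometric_hahn_banach_closed_point hconv hcl
    (x := φ) (fun ⟨a, ha⟩ => hφ a ha)
  have hf0 : ∀ u, f (A u) = 0 := by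
    intro u
    by_contra hne
    have := hf1 (A ((s / f (A u)) • u)) ⟨_, rfl⟩
    rw [map_smul, map_smul, smul_eq_mul, div_mul_cancel₀ _ hne] at this
    exact lt_irrefl _ this
  obtain ⟨v, hv⟩ := hsurj (f.comp W)
  have hv' : ∀ w, W v w = f (W w) := fun w => by rw [hv]; rfl
  have hAv : A v = 0 := by
    ext u
    obtain ⟨w, hw⟩ := hsurj (A u)
    have h1 := hv' w
    rw [hw, hf0, hanti, hw] at h1
    rw [hA]
    simpa using h1
  have v0 : v = 0 := hinj (by simpa using hAv)
  obtain ⟨w, hw⟩ := hsurj φ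
  have hφ0 : f φ = 0 := by rw [← hw, ← hv', v0]; simp
  have := hf1 (A 0) ⟨0, rfl⟩
  rw [hf0] at this
  linarith

theorem abs_left_inverse [CompleteSpace E] (W : E →L[ℝ] E →L[ℝ] ℝ)
    (hanti : ∀ u v, W u v = - W v u)
    (hsurj : ∀ φ : E →L[ℝ] ℝ, ∃ v, W v = φ) {c0 : ℝ} (hc0 : 0 < c0)
    (hW : ∀ u, c0 * ‖u‖ ≤ ‖W u‖)
    (T : E →L[ℝ] E) {c : ℝ} (hc : 0 < c) (hT : ∀ u, c * ‖u‖ ≤ ‖T u‖)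
    (P : E →L[ℝ] E) (hP : ∀ u, P (P u) = P u) (hWP : ∀ u v, W (P u) v = W u (P v))
    (F : Submodule ℝ E) [FiniteDimensional ℝ F] (hF : ∀ u, u - P u ∈ F)
    {c' : ℝ} (hc' : 0 < c')
    (hlow : ∀ u, P u = u → c' * ‖u‖ ≤ ‖(W (T u)).comp (T.comp P)‖) :
    ∃ L : E →L[ℝ] E, ∀ u, L (T u) = u := by
  let G : E →L[ℝ] E := ContinuousLinearMap.id ℝ E - P
  have hG : ∀ u, G u = u - P u := fun u => rfl
  let Φ : E →L[ℝ] E →L[ℝ] ℝ :=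
    ((ContinuousLinearMap.compL ℝ E E ℝ).flip (T.comp P)).comp W
  have hΦ : ∀ w, Φ w = (W w).comp (T.comp P) := fun w => rfl
  let A : E →L[ℝ] E →L[ℝ] ℝ := Φ.comp (T.comp P) +
    (((ContinuousLinearMap.compL ℝ E E ℝ).flip G).comp W).comp G
  have hA : ∀ u v, A u v = W (T (P u)) (T (P v)) + W (G u) (G v) := fun u v => rfl
  have hAanti : ∀ u v, A u v = - A v u := by
    intro u v
    rw [hA, hA, hanti (T (P u)), hanti (G u)]; ring
  have hGP : ∀ u, G (P u) = 0 := fun u => by rw [hG, hP, sub_self]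
  have hPG : ∀ u, P (G u) = 0 := fun u => by rw [hG, map_sub, hP, sub_self]
  have b1 : ∀ u, c' * ‖P u‖ ≤ ‖A u‖ * ‖P‖ := by
    intro u
    refine (hlow (P u) (hP u)).trans ?_
    have : (W (T (P u))).comp (T.comp P) = (A u).comp P := by
      ext v
      simp [hA, hGP, hP]
    rw [this]
    exact ContinuousLinearMap.opNorm_comp_le _ _
  have b2 : ∀ u, c0 * ‖G u‖ ≤ ‖A u‖ * ‖G‖ := by
    intro u
    refine (hW (G u)).trans ?_
    have : W (G u) = (A u).comp G := by
      ext v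
      have h1 : W (G u) (P v) = 0 := by rw [← hWP, hPG]; simp
      have h2 : G (G v) = G v := by rw [hG (G v), hPG, sub_zero]
      simp only [ContinuousLinearMap.comp_apply, hA, hPG, h2]
      rw [hG v, map_sub, h1]; simp
    rw [this]
    exact ContinuousLinearMap.opNorm_comp_le _ _
  have hK : 0 < ‖P‖ / c' + ‖G‖ / c0 + 1 := by positivity
  have b3 : ∀ u, (‖P‖ / c' + ‖G‖ / c0 + 1)⁻¹ * ‖u‖ ≤ ‖A u‖ := by
    intro u
    rw [inv_mul_le_iff₀ hK]
    have h1 : ‖P u‖ ≤ ‖A u‖ * ‖P‖ / c' := by rw [le_div_iff₀ hc', mul_comm]; exact b1 u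
    have h2 : ‖G u‖ ≤ ‖A u‖ * ‖G‖ / c0 := by rw [le_div_iff₀ hc0, mul_comm]; exact b2 u
    have h3 : ‖u‖ ≤ ‖P u‖ + ‖G u‖ := by
      have := norm_add_le (P u) (G u)
      rwa [hG, add_sub_cancel] at this
    have h4 := norm_nonneg (A u)
    calc ‖u‖ ≤ ‖A u‖ * ‖P‖ / c' + ‖A u‖ * ‖G‖ / c0 + ‖A u‖ := by linarith
      _ = _ := by ring
  have hsur := surj_of_lower W hanti hsurj A hAanti (inv_pos.2 hK) b3
  have hinj := (closed_range_of_lower A (inv_pos.2 hK) b3).2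
  let Ae := ContinuousLinearEquiv.ofBijective A (LinearMap.ker_eq_bot.2 hinj)
    (LinearMap.range_eq_top.2 hsur)
  have hAe : ∀ u, Ae.symm (A u) = u := fun u =>
    ContinuousLinearEquiv.ofBijective_symm_apply_apply A _ _ u
  let L0 : E →L[ℝ] E := P.comp ((Ae.symm : (E →L[ℝ] ℝ) →L[ℝ] E).comp Φ)
  have hL0 : ∀ u, L0 (T (P u)) = P u := by
    intro u
    have : Φ (T (P u)) = A (P u) := by
      ext v
      simp [hA, hΦ, hGP, hP]
    show P (Ae.symm (Φ (T (P u)))) = P u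
    rw [this, hAe, hP]
  let D : E →L[ℝ] E := ContinuousLinearMap.id ℝ E - L0.comp T
  have hD : ∀ u, D u = u - L0 (T u) := fun u => rfl
  have hDG : ∀ u, D u = D (u - P u) := by
    intro u
    have : D (P u) = 0 := by rw [hD, hL0, sub_self]
    rw [map_sub, this, sub_zero]
  obtain ⟨hcl, hTinj⟩ := closed_range_of_lower T hc hT
  let Te := ContinuousLinearMap.equivRange (f := T) hTinj hcl
  let f := D.comp (Te.symm : T.range →L[ℝ] E)
  have hfin : FiniteDimensional ℝ f.range := by
    apply Submodule.finiteDimensional_of_le (S₂ := F.map (D : E →ₗ[ℝ] E))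
    rintro _ ⟨w, rfl⟩
    refine ⟨Te.symm w - P (Te.symm w), hF _, ?_⟩
    exact (hDG _).symm
  obtain ⟨g, hg⟩ := ContinuousLinearMap.exist_extension_of_finiteDimensional_range f
  refine ⟨L0 + g, fun u => ?_⟩
  have h1 : g (T u) = D u := by
    have := congrArg (fun q => q (Te u)) hg
    have e : f (Te u) = D u := by
      show D (Te.symm (Te u)) = D u
      simp
    rw [← e]
    exact this.symm
  show L0 (T u) + g (T u) = u
  rw [h1, hD]; abel

end abstractpart

lemma OM_anti (u v : Z) : OM u v = - OM v u := om_antisymm u v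

instance : CompleteSpace Z := by
  have hlow : ∀ u, (1/4 : ℝ) * ‖u‖ ≤ ‖OM u‖ := fun u => by linarith [OM_lower u]
  have hA : AntilipschitzWith (Real.toNNReal 4) OM := by
    apply AddMonoidHomClass.antilipschitz_of_bound
    intro x
    rw [Real.coe_toNNReal _ (by norm_num)]
    exact OM_lower x
  have hU : IsUniformInducing OM := hA.isUniformInducing OM.uniformContinuous
  rw [completeSpace_iff_isComplete_range hU]
  have : range OM = univ := range_eq_univ.2 OM_surj
  rw [this]
  exact isComplete_univ


def NnP : (RSeq × RSeq) →ₗ[ℝ] (RSeq × RSeq) where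
  toFun u := (u.2, 0)
  map_add' u v := by ext n <;> simp
  map_smul' c u := by ext n <;> simp

def NnL : Z →ₗ[ℝ] Z := NnP.restrict (p := Zsub) (q := Zsub) (fun _ hu => memZ2_j hu.1)

lemma NnL_le (u : Z) : zn (NnL u) ≤ 1 * zn u := by
  have h : zn (NnL u) = l2norm (vl u).2 := Z2norm_j _
  rw [h, one_mul]
  have := l2norm_nonneg ((vl u).1 - KP (vl u).2)
  unfold zn Z2norm
  linarith

/-- the operator `(ω, x) ↦ (x, 0)` -/
def Nn : Z →L[ℝ] Z := mkZ NnL 1 NnL_le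

lemma Nn_apply (u : Z) : Nn u = jj (vl u).2 (vl_mem u).1 := rfl
lemma vl_Nn (u : Z) : vl (Nn u) = ((vl u).2, 0) := rfl
lemma Nn_kk (x : RSeq) (h : memL2 x) : Nn (kk x h) = jj x h := rfl

lemma zero_of_cut {A : Set ℕ} {u : Z} (h : cut A u = u) {n : ℕ} (hn : n ∉ A) :
    (vl u).1 n = 0 ∧ (vl u).2 n = 0 := by
  rw [← h, vl_cut]
  simp [hn]

lemma cut_of_zero {A : Set ℕ} {u : Z} (h : ∀ n, n ∉ A → (vl u).1 n = 0 ∧ (vl u).2 n = 0) :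
    cut A u = u := by
  apply vl_inj
  rw [vl_cut]
  ext n
  · by_cases hn : n ∈ A
    · simp [hn]
    · simp [hn, (h n hn).1]
  · by_cases hn : n ∈ A
    · simp [hn]
    · simp [hn, (h n hn).2]

lemma cut_kk {A : Set ℕ} {x : RSeq} (hx : memL2 x) (h : ∀ n, n ∉ A → x n = 0) :
    cut A (kk x hx) = kk x hx := by
  apply cut_of_zero
  intro n hn
  refine ⟨?_, h n hn⟩
  show KP x n = 0
  simp [KP, h n hn]

/-- Normalized block. -/
def isBlk (K : ℝ) (A : Set ℕ) (p : Z) : Prop :=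
  cut A p = p ∧ l2norm (vl p).2 = 1 ∧ l2norm ((vl p).1 - KP (vl p).2) ≤ K

lemma isBlk_kk {A : Set ℕ} {x : RSeq} (hx : memL2 x) (h : ∀ n, n ∉ A → x n = 0)
    (h1 : l2norm x = 1) : isBlk 0 A (kk x hx) := by
  refine ⟨cut_kk hx h, h1, ?_⟩
  show l2norm (KP x - KP x) ≤ 0
  rw [sub_self, l2norm_zero]

lemma pyth {x y : RSeq} (hx : memL2 x) (hy : memL2 y) (h : ∀ n, x n * y n = 0) :
    l2norm (x + y) ^ 2 = l2norm x ^ 2 + l2norm y ^ 2 := by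
  rw [l2norm_sq, l2norm_sq, l2norm_sq, ← Summable.tsum_add hx hy]
  apply tsum_congr
  intro n
  have := h n
  simp only [Pi.add_apply]
  linear_combination 2 * this

lemma memL2_sum (h : ℕ → RSeq) (hh : ∀ n, memL2 (h n)) (m : ℕ) :
    memL2 (∑ n ∈ Finset.range m, h n) := by
  induction m with
  | zero => simpa using memL2_zero
  | succ m ih => rw [Finset.sum_range_succ]; exact ih.add (hh m)

lemma pyth_sum (I : ℕ → Set ℕ) (hI : ∀ i j, i ≠ j → Disjoint (I i) (I j))
    (h : ℕ → RSeq) (hh : ∀ n, memL2 (h n)) (hs : ∀ n k, k ∉ I n → h n k = 0) (m : ℕ) :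
    l2norm (∑ n ∈ Finset.range m, h n) ^ 2 = ∑ n ∈ Finset.range m, l2norm (h n) ^ 2 := by
  induction m with
  | zero => simp [l2norm_zero]
  | succ m ih =>
    rw [Finset.sum_range_succ, Finset.sum_range_succ, pyth (memL2_sum h hh m) (hh m), ih]
    intro k
    by_cases hk : k ∈ I m
    · rw [Finset.sum_apply, Finset.sum_eq_zero, zero_mul]
      intro i hi
      apply hs
      intro hki
      have : i ≠ m := by simp at hi; omega
      exact (Set.disjoint_left.1 (hI i m this)) hki hk
    · rw [hs m k hk, mul_zero]

lemma blk_sum {m : ℕ} (hm : 1 ≤ m) {K : ℝ} (hK : 0 ≤ K) (I : ℕ → Set ℕ)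
    (hI : ∀ i j, i ≠ j → Disjoint (I i) (I j)) (p : ℕ → Z) (hp : ∀ n, isBlk K (I n) (p n))
    (ε : ℕ → ℝ) (hε : ∀ n, ε n = 1 ∨ ε n = -1) :
    zn (∑ n ∈ Finset.range m, ε n • (p n - Real.log m • Nn (p n))) ≤ Real.sqrt m * (K + 1) := by
  have hm0 : (0 : ℝ) < m := by exact_mod_cast hm
  have hsm : 0 < Real.sqrt m := Real.sqrt_pos.2 hm0
  have habs : ∀ n, |ε n| = 1 := fun n => by rcases hε n with h | h <;> simp [h]
  set L := Real.log m with hL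
  let x : ℕ → RSeq := fun n => (vl (p n)).2
  let w : ℕ → RSeq := fun n => (vl (p n)).1
  have hxz : ∀ n k, k ∉ I n → x n k = 0 := fun n k hk => (zero_of_cut (hp n).1 hk).2
  have hwz : ∀ n k, k ∉ I n → w n k = 0 := fun n k hk => (zero_of_cut (hp n).1 hk).1
  have hxm : ∀ n, memL2 (x n) := fun n => (vl_mem (p n)).1
  have hx1 : ∀ n, l2norm (x n) = 1 := fun n => (hp n).2.1
  let g : ℕ → RSeq := fun n => w n - KP (x n)
  have hgm : ∀ n, memL2 (g n) := fun n => (vl_mem (p n)).2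
  have hgK : ∀ n, l2norm (g n) ≤ K := fun n => (hp n).2.2
  have hKz : ∀ n k, k ∉ I n → KP (x n) k = 0 := fun n k hk => by simp [KP, hxz n k hk]
  have hgz : ∀ n k, k ∉ I n → g n k = 0 := fun n k hk => by
    simp [g, hwz n k hk, hKz n k hk]
  have hS : vl (∑ n ∈ Finset.range m, ε n • (p n - L • Nn (p n))) =
      (∑ n ∈ Finset.range m, ε n • (w n - L • x n), ∑ n ∈ Finset.range m, ε n • x n) := by
    rw [map_sum]
    ext k
    · simp [Prod.fst_sum, vl_Nn, w, x]
    · simp [Prod.snd_sum, vl_Nn, x]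
  have n1 : l2norm (∑ n ∈ Finset.range m, ε n • x n) = Real.sqrt m := by
    have := pyth_sum I hI (fun n => ε n • x n) (fun n => (hxm n).smul _)
      (fun n k hk => by simp [hxz n k hk]) m
    simp only [l2norm_smul, habs, hx1] at this
    rw [← Real.sqrt_sq (l2norm_nonneg _), this]
    simp
  have n2 : l2norm (∑ n ∈ Finset.range m, ε n • g n) ≤ Real.sqrt m * K := by
    have := pyth_sum I hI (fun n => ε n • g n) (fun n => (hgm n).smul _)
      (fun n k hk => by simp [hgz n k hk]) m
    simp only [l2norm_smul, habs, one_mul] at this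
    apply le_of_sq_le_sq _ (by positivity)
    rw [this, mul_pow, Real.sq_sqrt hm0.le]
    calc _ ≤ ∑ n ∈ Finset.range m, K ^ 2 := Finset.sum_le_sum fun n _ =>
          pow_le_pow_left₀ (l2norm_nonneg _) (hgK n) 2
      _ = _ := by simp
  have n3 : ∑ n ∈ Finset.range m, ε n • (w n - L • x n) - KP (∑ n ∈ Finset.range m, ε n • x n)
      = ∑ n ∈ Finset.range m, ε n • g n := by
    funext k
    by_cases hk : ∃ n0 ∈ Finset.range m, k ∈ I n0
    · obtain ⟨n0, hn0, hk0⟩ := hk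
      have hne : ∀ b, b ≠ n0 → k ∉ I b := fun b hb hkb =>
        (Set.disjoint_left.1 (hI b n0 hb)) hkb hk0
      have s1 : (∑ n ∈ Finset.range m, ε n • x n) k = ε n0 * x n0 k := by
        rw [Finset.sum_apply, Finset.sum_eq_single_of_mem n0 hn0]
        · simp
        · intro b _ hb; simp [hxz b k (hne b hb)]
      have s2 : (∑ n ∈ Finset.range m, ε n • (w n - L • x n)) k =
          ε n0 * (w n0 k - L * x n0 k) := by
        rw [Finset.sum_apply, Finset.sum_eq_single_of_mem n0 hn0]
        · simp
        · intro b _ hb; simp [hxz b k (hne b hb), hwz b k (hne b hb)]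
      have s3 : (∑ n ∈ Finset.range m, ε n • g n) k = ε n0 * (w n0 k - KP (x n0) k) := by
        rw [Finset.sum_apply, Finset.sum_eq_single_of_mem n0 hn0]
        · simp [g]
        · intro b _ hb; simp [hgz b k (hne b hb)]
      have s4 : KP (∑ n ∈ Finset.range m, ε n • x n) k =
          ε n0 * (KP (x n0) k - L * x n0 k) := by
        simp only [KP]
        rw [s1, n1, hx1, abs_mul, habs, one_mul]
        by_cases h0 : x n0 k = 0
        · simp [h0]
        · rw [Real.log_div (abs_ne_zero.2 h0) hsm.ne', Real.log_sqrt hm0.le, div_one, ← hL]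
          ring
      rw [Pi.sub_apply, s2, s3, s4]; ring
    · push Not at hk
      have s1 : (∑ n ∈ Finset.range m, ε n • x n) k = 0 := by
        rw [Finset.sum_apply, Finset.sum_eq_zero]
        intro n hn; simp [hxz n k (hk n hn)]
      have s2 : (∑ n ∈ Finset.range m, ε n • (w n - L • x n)) k = 0 := by
        rw [Finset.sum_apply, Finset.sum_eq_zero]
        intro n hn; simp [hxz n k (hk n hn), hwz n k (hk n hn)]
      have s3 : (∑ n ∈ Finset.range m, ε n • g n) k = 0 := by
        rw [Finset.sum_apply, Finset.sum_eq_zero]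
        intro n hn; simp [hgz n k (hk n hn)]
      rw [Pi.sub_apply, s2, s3]
      simp [KP, s1]
  unfold zn Z2norm
  rw [hS]
  simp only
  rw [n3, n1]
  linarith

lemma sign_choice (b : Z →L[ℝ] Z →L[ℝ] ℝ) (p q : ℕ → Z) (m : ℕ) :
    ∃ ε : ℕ → ℝ, (∀ n, ε n = 1 ∨ ε n = -1) ∧
      ∑ n ∈ Finset.range m, b (p n) (q n) ≤
        b (∑ n ∈ Finset.range m, ε n • p n) (∑ n ∈ Finset.range m, ε n • q n) := by
  induction m with
  | zero => exact ⟨fun _ => 1, fun _ => Or.inl rfl, by simp⟩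
  | succ m ih =>
    obtain ⟨ε, h1, h2⟩ := ih
    set S := ∑ n ∈ Finset.range m, ε n • p n
    set R := ∑ n ∈ Finset.range m, ε n • q n
    have key : ∃ s : ℝ, (s = 1 ∨ s = -1) ∧ 0 ≤ s * (b S (q m) + b (p m) R) := by
      rcases le_total 0 (b S (q m) + b (p m) R) with h | h
      · exact ⟨1, Or.inl rfl, by linarith⟩
      · exact ⟨-1, Or.inr rfl, by linarith⟩
    obtain ⟨s, hs, hs2⟩ := key
    refine ⟨fun n => if n < m then ε n else s, fun n => ?_, ?_⟩
    · by_cases h : n < m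
      · simpa [h] using h1 n
      · simpa [h] using hs
    · rw [Finset.sum_range_succ, Finset.sum_range_succ, Finset.sum_range_succ]
      have e1 : ∑ n ∈ Finset.range m, (if n < m then ε n else s) • p n = S :=
        Finset.sum_congr rfl fun n hn => by simp at hn; simp [hn]
      have e2 : ∑ n ∈ Finset.range m, (if n < m then ε n else s) • q n = R :=
        Finset.sum_congr rfl fun n hn => by simp at hn; simp [hn]
      rw [e1, e2]
      simp only [lt_irrefl, if_false]
      have hss : s * s = 1 := by rcases hs with h | h <;> simp [h]
      simp only [map_add, map_smul, ContinuousLinearMap.add_apply, ContinuousLinearMap.smul_apply,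
        smul_eq_mul]
      have e3 : b S R + s * (b (p m) R) + s * (b S (q m) + s * b (p m) (q m)) =
          b S R + s * (b S (q m) + b (p m) R) + b (p m) (q m) := by
        linear_combination (b (p m) (q m)) * hss
      linarith

lemma om_T_le (T : Z →L[ℝ] Z) (u w : Z) : |om (T u) w| ≤ 96 * ‖T‖ * (zn u * zn w) := by
  have a := om_le_norm (T u) w
  have b := T.le_opNorm u
  have c := norm_le_zn u
  have d := zn_nonneg w
  have e := zn_nonneg u
  have f := norm_nonneg T
  have g : ‖T u‖ ≤ ‖T‖ * (4 * zn u) := b.trans (mul_le_mul_of_nonneg_left c f)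
  have h : ‖T u‖ * zn w ≤ ‖T‖ * (4 * zn u) * zn w := mul_le_mul_of_nonneg_right g d
  have i : 0 ≤ ‖T‖ * (zn u * zn w) := by positivity
  nlinarith

lemma block2 (T : Z →L[ℝ] Z) {K : ℝ} (hK : 0 ≤ K) : ∃ C0 : ℝ, 0 ≤ C0 ∧ ∀ m : ℕ, 1 ≤ m →
    ¬ ∀ M : ℕ, ∃ M' p q, M ≤ M' ∧ isBlk K (Ico M M') p ∧ isBlk K (Ico M M') q ∧
      C0 < om (T (p - Real.log m • Nn p)) (q - Real.log m • Nn q) := by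
  refine ⟨96 * ‖T‖ * (K + 1) ^ 2, by positivity, fun m hm H => ?_⟩
  choose f g k hf hg hk hv using H
  let M : ℕ → ℕ := fun n => f^[n] 0
  have hM : ∀ n, M (n + 1) = f (M n) := fun n => Function.iterate_succ_apply' f n 0
  have hmono : Monotone M := monotone_nat_of_le_succ fun n => by rw [hM]; exact hf _
  let I : ℕ → Set ℕ := fun n => Ico (M n) (f (M n))
  have hI : ∀ i j, i ≠ j → Disjoint (I i) (I j) := by
    intro i j hij
    have := hmono.pairwise_disjoint_on_Ico_succ hij
    simpa [Function.onFun, I, hM] using this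
  have hm0 : (0 : ℝ) < m := by exact_mod_cast hm
  set L := Real.log m with hL
  let p : ℕ → Z := fun n => g (M n)
  let q : ℕ → Z := fun n => k (M n)
  obtain ⟨ε, hε, hsum⟩ := sign_choice (OM.comp T) (fun n => p n - L • Nn (p n))
    (fun n => q n - L • Nn (q n)) m
  have b1 := blk_sum hm hK I hI p (fun n => hg (M n)) ε hε
  have b2 := blk_sum hm hK I hI q (fun n => hk (M n)) ε hε
  have b3 := om_T_le T (∑ n ∈ Finset.range m, ε n • (p n - L • Nn (p n)))
    (∑ n ∈ Finset.range m, ε n • (q n - L • Nn (q n)))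
  have b4 := mul_le_mul b1 b2 (zn_nonneg _) (by positivity)
  have b5 := mul_le_mul_of_nonneg_left b4 (by positivity : 0 ≤ 96 * ‖T‖)
  have b6 : ∑ n ∈ Finset.range m, 96 * ‖T‖ * (K + 1) ^ 2 <
      ∑ n ∈ Finset.range m, (OM.comp T) (p n - L • Nn (p n)) (q n - L • Nn (q n)) := by
    apply Finset.sum_lt_sum_of_nonempty
    · simp; omega
    · intro n _
      exact hv (M n)
  rw [Finset.sum_const, Finset.card_range, nsmul_eq_mul] at b6
  have b7 : Real.sqrt m * (K + 1) * (Real.sqrt m * (K + 1)) = m * (K + 1) ^ 2 := by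
    have := Real.mul_self_sqrt hm0.le
    linear_combination (K + 1) ^ 2 * this
  rw [b7] at b5
  have b8 := (le_abs_self _).trans (b3.trans b5)
  have b9 := b6.trans_le (hsum.trans b8)
  linarith

lemma val_expand (T : Z →L[ℝ] Z) (L : ℝ) (p q : Z) :
    om (T (p - L • Nn p)) (q - L • Nn q) = om (T p) q - L * (om (T (Nn p)) q + om (T p) (Nn q))
      + L ^ 2 * om (T (Nn p)) (Nn q) := by
  simp only [← OM_apply, map_sub, map_smul, ContinuousLinearMap.sub_apply,
    ContinuousLinearMap.smul_apply, smul_eq_mul]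
  ring

lemma tailfun (φ : Z →L[ℝ] ℝ) {η : ℝ} (hη : 0 < η) :
    ∀ᶠ N : ℕ in atTop, ∀ u, cut (Ici N) u = u → |φ u| ≤ η * ‖u‖ := by
  obtain ⟨v, rfl⟩ := OM_surj φ
  have h := (tendsto_zero_iff_norm_tendsto_zero.1 (cut_tail v)).eventually
    (gt_mem_nhds (by positivity : 0 < η / 6))
  filter_upwards [h] with N hN u hu
  rw [OM_apply, ← hu, ← om_cut, hu]
  refine (om_norm _ _).trans ?_
  apply mul_le_mul_of_nonneg_right _ (norm_nonneg _)
  linarith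

lemma tailT (T : Z →L[ℝ] Z) (M : ℕ) : ∀ {η : ℝ}, 0 < η →
    ∀ᶠ N : ℕ in atTop, ∀ u, cut (Ici N) u = u → ‖cut (Iio M) (T u)‖ ≤ η * ‖u‖ := by
  induction M with
  | zero =>
    intro η hη
    refine Eventually.of_forall fun N u _ => ?_
    rw [cut_eq_sum]
    simp
    positivity
  | succ M ih =>
    intro η hη
    have h1 := ih (half_pos hη)
    have h2 := tailfun ((OM.flip (e2 M)).comp T)
      (by positivity : 0 < η / 4 / (‖e1 M‖ + 1))
    have h3 := tailfun ((OM.flip (e1 M)).comp T)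
      (by positivity : 0 < η / 4 / (‖e2 M‖ + 1))
    filter_upwards [h1, h2, h3] with N h1 h2 h3 u hu
    have e := cut_eq_sum (M + 1) (T u)
    rw [Finset.sum_range_succ, ← cut_eq_sum] at e
    rw [e]
    have a1 := h1 u hu
    have a2 : |(vl (T u)).1 M| ≤ η / 4 / (‖e1 M‖ + 1) * ‖u‖ := by
      have := h2 u hu
      rwa [ContinuousLinearMap.comp_apply, ContinuousLinearMap.flip_apply, OM_apply, om_e2] at this
    have a3 : |(vl (T u)).2 M| ≤ η / 4 / (‖e2 M‖ + 1) * ‖u‖ := by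
      have := h3 u hu
      rwa [ContinuousLinearMap.comp_apply, ContinuousLinearMap.flip_apply, OM_apply, om_e1,
        abs_neg] at this
    have aux : ∀ (a : ℝ) (z : Z), |a| ≤ η / 4 / (‖z‖ + 1) * ‖u‖ → ‖a • z‖ ≤ η / 4 * ‖u‖ := by
      intro a z h
      rw [norm_smul, Real.norm_eq_abs]
      have hz := norm_nonneg z
      calc |a| * ‖z‖ ≤ |a| * (‖z‖ + 1) := by
            apply mul_le_mul_of_nonneg_left (by linarith) (abs_nonneg _)
        _ ≤ η / 4 / (‖z‖ + 1) * ‖u‖ * (‖z‖ + 1) := by gcongr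
        _ = η / 4 * ‖u‖ := by field_simp
    have c2 := aux _ _ a2
    have c3 := aux _ _ a3
    refine (norm_add_le _ _).trans ?_
    have := norm_add_le ((vl (T u)).1 M • e1 M) ((vl (T u)).2 M • e2 M)
    linarith

lemma cut3 {M M' : ℕ} (h : M ≤ M') (u : Z) :
    u = cut (Iio M) u + cut (Ico M M') u + cut (Ici M') u := by
  apply vl_inj
  rw [map_add, map_add, vl_cut, vl_cut, vl_cut]
  ext n
  · rcases lt_or_ge n M with a | a
    · simp [indicator, a, Nat.not_le.2 a, Nat.not_le.2 (lt_of_lt_of_le a h)]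
    · rcases lt_or_ge n M' with b | b
      · simp [indicator, a, Nat.not_lt.2 a, b, Nat.not_le.2 b]
      · simp [indicator, Nat.not_lt.2 a, b, Nat.not_lt.2 b]
  · rcases lt_or_ge n M with a | a
    · simp [indicator, a, Nat.not_le.2 a, Nat.not_le.2 (lt_of_lt_of_le a h)]
    · rcases lt_or_ge n M' with b | b
      · simp [indicator, a, Nat.not_lt.2 a, b, Nat.not_le.2 b]
      · simp [indicator, Nat.not_lt.2 a, b, Nat.not_lt.2 b]

lemma snd_le_zn (u : Z) : l2norm (vl u).2 ≤ zn u := by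
  have := l2norm_nonneg ((vl u).1 - KP (vl u).2)
  unfold zn Z2norm
  linarith

lemma om_jj (u : Z) {v : RSeq} (hv : memL2 v) : om u (jj v hv) = - ∑' n, (vl u).2 n * v n := by
  rw [← tsum_neg]
  unfold om Om
  apply tsum_congr
  intro n
  show (vl u).1 n * (0 : RSeq) n - (vl u).2 n * v n = _
  simp

lemma exists_log_ge (R : ℝ) : ∃ m : ℕ, 1 ≤ m ∧ R ≤ Real.log m := by
  have := (Real.tendsto_log_atTop.comp tendsto_natCast_atTop_atTop).eventually_ge_atTop R
  obtain ⟨m, h1, h2⟩ := (this.and (eventually_ge_atTop 1)).exists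
  exact ⟨m, h2, h1⟩


lemma ind_mul_tsum (A : Set ℕ) (d : RSeq) :
    ∑' n, d n * A.indicator d n = l2norm (A.indicator d) ^ 2 := by
  rw [l2norm_sq]
  apply tsum_congr
  intro n
  by_cases h : n ∈ A <;> simp [h]; ring

lemma jj_congr {x y : RSeq} (h : x = y) (hx : memL2 x) (hy : memL2 y) : jj x hx = jj y hy := by
  subst h; rfl

lemma jj_smul (c : ℝ) {x : RSeq} (hx : memL2 x) (hc : memL2 (c • x)) :
    jj (c • x) hc = c • jj x hx := by
  apply vl_inj
  rw [map_smul]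
  show (c • x, (0 : RSeq)) = c • (x, 0)
  simp

lemma cut_jj {A : Set ℕ} {x : RSeq} (hx : memL2 x) (h : ∀ n, n ∉ A → x n = 0) :
    cut A (jj x hx) = jj x hx := by
  apply cut_of_zero
  intro n hn
  exact ⟨h n hn, rfl⟩

lemma lemD (T : Z →L[ℝ] Z) {ε : ℝ} (hε : 0 < ε) :
    ∃ N : ℕ, ∀ x (hx : fin0 x), (∀ n < N, x n = 0) →
      l2norm (vl (T (jj x hx.memL2))).2 ≤ ε * l2norm x := by
  by_contra hcon
  push Not at hcon
  obtain ⟨C0, hC0, hbl⟩ := block2 T (le_refl (0 : ℝ))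
  set a := 96 * ‖T‖ with ha
  have ha0 : 0 ≤ a := by positivity
  obtain ⟨m, hm1, hm⟩ := exists_log_ge (1 + (3 * a + C0 + 1) * (2 / ε))
  set L := Real.log m with hL
  have hL1 : 1 ≤ L := by
    have : 0 ≤ (3 * a + C0 + 1) * (2 / ε) := by positivity
    linarith
  have hLe : 3 * a + C0 + 1 ≤ L * (ε / 2) := by
    have h : (3 * a + C0 + 1) * (2 / ε) ≤ L := by linarith
    calc 3 * a + C0 + 1 = (3 * a + C0 + 1) * (2 / ε) * (ε / 2) := by field_simp
      _ ≤ L * (ε / 2) := by gcongr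
  apply hbl m hm1
  intro M
  obtain ⟨N, hN, hNM⟩ := ((tailT T M (by positivity : 0 < ε / 96)).and
    (eventually_ge_atTop M)).exists
  obtain ⟨x, hx, hxz, hbad⟩ := hcon N
  have hx0 : 0 < l2norm x := by
    rcases (l2norm_nonneg x).eq_or_lt with h | h
    · exfalso
      have : x = 0 := l2norm_eq_zero hx.memL2 h.symm
      have e : jj x hx.memL2 = 0 := by
        apply vl_inj
        rw [map_zero]
        show (x, (0 : RSeq)) = 0
        rw [this]; rfl
      rw [e] at hbad
      simp [l2norm_zero, ← h] at hbad
    · exact h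
  set x1 : RSeq := (l2norm x)⁻¹ • x with hx1
  have mx1 : memL2 x1 := hx.memL2.smul _
  have nx1 : l2norm x1 = 1 := by
    rw [hx1, l2norm_smul, abs_of_pos (inv_pos.2 hx0), inv_mul_cancel₀ hx0.ne']
  set t := T (jj x1 mx1) with ht
  set d := (vl t).2 with hd
  have md : memL2 d := (vl_mem t).1
  have nd : ε < l2norm d := by
    have : d = (l2norm x)⁻¹ • (vl (T (jj x hx.memL2))).2 := by
      rw [hd, ht, jj_smul _ hx.memL2, map_smul, map_smul]; rfl
    rw [this, l2norm_smul, abs_of_pos (inv_pos.2 hx0), inv_mul_eq_div, lt_div_iff₀ hx0]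
    exact hbad
  obtain ⟨K0, hK0⟩ := hx
  have hx1z : ∀ n, n < N ∨ K0 ≤ n → x1 n = 0 := by
    intro n hn
    rcases hn with h | h
    · simp [hx1, hxz n h]
    · simp [hx1, hK0 n h]
  have i1 : l2norm ((Iio M).indicator d) ≤ ε / 4 := by
    have h1 := hN (jj x1 mx1) (cut_jj mx1 (fun n hn => hx1z n (Or.inl (by simpa using hn))))
    have h2 := snd_le_zn (cut (Iio M) t)
    have h3 := zn_le_norm (cut (Iio M) t)
    have h4 := norm_le_zn (jj x1 mx1)
    rw [zn_jj, nx1] at h4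
    have h5 : ε / 96 * ‖jj x1 mx1‖ ≤ ε / 96 * (4 * 1) := by gcongr
    have h6 : l2norm (vl (cut (Iio M) t)).2 = l2norm ((Iio M).indicator d) := rfl
    linarith
  obtain ⟨M', hM', hMM, hKM⟩ := (((ind_tail md).eventually
    (ge_mem_nhds (by positivity : 0 < ε / 4))).and
    ((eventually_ge_atTop M).and (eventually_ge_atTop K0))).exists
  set d1 := (Ico M M').indicator d with hd1
  have md1 : memL2 d1 := memL2_ind _ md
  have hdec : d = (Iio M).indicator d + d1 + (Ici M').indicator d := by
    have := congrArg (fun z => (vl z).2) (cut3 hMM t)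
    simpa [vl_cut, map_add] using this
  have nd1 : ε / 2 ≤ l2norm d1 := by
    have h1 := l2norm_add_le ((memL2_ind (Iio M) md).add md1) (memL2_ind (Ici M') md)
    have h2 := l2norm_add_le (memL2_ind (Iio M) md) md1
    rw [← hdec] at h1
    linarith
  have hd10 : 0 < l2norm d1 := by linarith
  set v : RSeq := (-(l2norm d1)⁻¹) • d1 with hv
  have mv : memL2 v := md1.smul _
  have nv : l2norm v = 1 := by
    rw [hv, l2norm_smul, abs_neg, abs_of_pos (inv_pos.2 hd10), inv_mul_cancel₀ hd10.ne']
  refine ⟨M', kk x1 mx1, kk v mv, hMM, isBlk_kk mx1 ?_ nx1, isBlk_kk mv ?_ nv, ?_⟩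
  · intro n hn
    apply hx1z
    simp only [mem_Ico, not_and_or] at hn
    omega
  · intro n hn
    simp [hv, hd1, hn]
  rw [val_expand, Nn_kk, Nn_kk, ← ht, ← hL]
  have hA := om_T_le T (kk x1 mx1) (kk v mv)
  have hB1 := om_T_le T (jj x1 mx1) (kk v mv)
  have hB2 := om_T_le T (kk x1 mx1) (jj v mv)
  rw [zn_kk, zn_kk, nx1, nv] at hA
  rw [zn_jj, zn_kk, nx1, nv] at hB1
  rw [zn_kk, zn_jj, nx1, nv] at hB2
  have hD : om t (jj v mv) = l2norm d1 := by
    rw [om_jj, ← hd]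
    have : ∀ n, d n * v n = (-(l2norm d1)⁻¹) * (d n * d1 n) := fun n => by
      simp [hv]; ring
    simp_rw [this]
    rw [tsum_mul_left, hd1, ind_mul_tsum, ← hd1]
    field_simp
  rw [hD]
  rw [← ha] at hA hB1 hB2
  rw [← ht] at hB1
  rw [abs_le] at hA hB1 hB2
  set A := om (T (kk x1 mx1)) (kk v mv)
  set B1 := om t (kk v mv)
  set B2 := om (T (kk x1 mx1)) (jj v mv)
  have hB : L * (B1 + B2) ≤ L * (2 * a) := by
    apply mul_le_mul_of_nonneg_left _ (by linarith); linarith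
  have hDD : L * (3 * a + C0 + 1) ≤ L ^ 2 * l2norm d1 := by
    calc L * (3 * a + C0 + 1) ≤ L * (L * (ε / 2)) := by gcongr
      _ ≤ L * (L * l2norm d1) := by gcongr
      _ = _ := by ring
  have hf : a + C0 + 1 ≤ L * (a + C0 + 1) := le_mul_of_one_le_left (by positivity) hL1
  nlinarith

lemma isBlk.mono {K K' : ℝ} {A : Set ℕ} {p : Z} (h : isBlk K A p) (hK : K ≤ K') :
    isBlk K' A p := ⟨h.1, h.2.1, h.2.2.trans hK⟩

lemma om_neg_left (u v : Z) : om (-u) v = - om u v := by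
  have := om_smul_left (-1) u v
  simpa using this

lemma om_jj_kk {x y : RSeq} (hx : memL2 x) (hy : memL2 y) :
    om (jj x hx) (kk y hy) = ∑' n, x n * y n := by
  unfold om Om
  apply tsum_congr
  intro n
  show x n * y n - (0 : RSeq) n * KP y n = _
  simp

lemma om_jj_jj {x y : RSeq} (hx : memL2 x) (hy : memL2 y) :
    om (jj x hx) (jj y hy) = 0 := by
  rw [om_jj]
  show - ∑' n, (0 : RSeq) n * y n = 0
  simp

lemma lemF (T : Z →L[ℝ] Z) {c K κ : ℝ} (hc : 0 < c) (hT : ∀ u, c * ‖u‖ ≤ ‖T u‖) (hK : 0 ≤ K)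
    (hκ : κ = (c / 48) ^ 2 / 2)
    (H : ∀ N : ℕ, ∃ M' p, isBlk K (Ico N M') p ∧ |om (T (Nn p)) (T p)| ≤ κ) : False := by
  obtain ⟨C0, hC0, hbl⟩ := block2 (-T) hK
  set l0 := c / 48 with hl0
  have hl : 0 < l0 := by positivity
  set a := 96 * ‖T‖ * (K + 1) with ha
  have ha0 : 0 ≤ a := by positivity
  set b := 24 * ‖T‖ * (K + 1) with hb
  have hb0 : 0 ≤ b := by positivity
  obtain ⟨m, hm1, hm⟩ := exists_log_ge ((C0 + a + 2) * (4 / l0))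
  set L := Real.log m with hL
  have hL0 : 0 ≤ L := by
    have : 0 ≤ (C0 + a + 2) * (4 / l0) := by positivity
    linarith
  have hLe : C0 + a + 2 ≤ L * (l0 / 4) := by
    calc C0 + a + 2 = (C0 + a + 2) * (4 / l0) * (l0 / 4) := by field_simp
      _ ≤ L * (l0 / 4) := by gcongr
  obtain ⟨err, herr, he1, he2, he3⟩ : ∃ err : ℝ, 0 < err ∧ err ≤ c / 12 ∧
      err * (1 + b / l0) ≤ l0 / 4 ∧ L ^ 2 * err ≤ 1 := by
    refine ⟨min (c / 12) (min (l0 / 4 / (1 + b / l0)) (1 / (L ^ 2 + 1))), by positivity,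
      min_le_left _ _, ?_, ?_⟩
    · rw [← le_div_iff₀ (by positivity)]
      exact (min_le_right _ _).trans (min_le_left _ _)
    · have h : min (c / 12) (min (l0 / 4 / (1 + b / l0)) (1 / (L ^ 2 + 1))) ≤ 1 / (L ^ 2 + 1) :=
        (min_le_right _ _).trans (min_le_right _ _)
      calc _ ≤ L ^ 2 * (1 / (L ^ 2 + 1)) := by gcongr
        _ ≤ 1 := by
          rw [mul_one_div, div_le_one (by positivity)]; linarith
  set η := err / 300 with hη
  have hη0 : 0 < η := by positivity
  obtain ⟨N0, hN0⟩ := lemD T hη0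
  apply hbl m hm1
  intro M
  obtain ⟨N, hN, hNM, hNN⟩ := ((tailT T M hη0).and
    ((eventually_ge_atTop M).and (eventually_ge_atTop N0))).exists
  obtain ⟨M1, p, hp, hpk⟩ := H N
  set x := (vl p).2 with hx
  have hxz : ∀ n, n ∉ Ico N M1 → x n = 0 := fun n hn => (zero_of_cut hp.1 hn).2
  have fx : fin0 x := ⟨M1, fun n hn => hxz n (by simp; omega)⟩
  have nx : l2norm x = 1 := hp.2.1
  have zp : zn p ≤ K + 1 := by
    have := hp.2.2
    unfold zn Z2norm
    rw [← hx, nx]; linarith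
  have eN : Nn p = jj x fx.memL2 := rfl
  set t := T (Nn p) with ht
  set d := (vl t).2 with hd
  have md : memL2 d := (vl_mem t).1
  have nN : ‖Nn p‖ ≤ 4 := by
    have := norm_le_zn (Nn p)
    rw [eN, zn_jj, nx] at this
    rw [eN]; linarith
  have nN' : 1 / 6 ≤ ‖Nn p‖ := by
    have := zn_le_norm (Nn p)
    rw [eN, zn_jj, nx] at this
    rw [eN]; linarith
  have nd : l2norm d ≤ η := by
    have := hN0 x fx (fun n hn => hxz n (by simp; omega))
    rw [nx, mul_one] at this
    exact this
  have r1 : ‖cut (Iio M) t‖ ≤ 4 * η := by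
    have := hN (Nn p) (by
      rw [eN]; exact cut_jj _ (fun n hn => hxz n (by simp at hn ⊢; omega)))
    have h2 : η * ‖Nn p‖ ≤ η * 4 := by gcongr
    linarith
  obtain ⟨M', r2, hMM, hKM⟩ := ((((tendsto_zero_iff_norm_tendsto_zero.1 (cut_tail t)).eventually
    (ge_mem_nhds hη0))).and
    ((eventually_ge_atTop M).and (eventually_ge_atTop M1))).exists
  have r3 : ‖cut (Ico M M') (kk d md)‖ ≤ 288 * η := by
    have h1 := cut_opnorm (Ico M M') (kk d md)
    have h2 := norm_le_zn (kk d md)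
    rw [zn_kk] at h2
    linarith
  set w := cut (Ico M M') (t - kk d md) with hw
  have w2 : (vl w).2 = 0 := by
    rw [hw, vl_cut, map_sub]
    show (Ico M M').indicator (d - d) = 0
    rw [sub_self]; simp
  set v0 := (vl w).1 with hv0
  have mv0 : memL2 v0 := by
    have := (vl_mem w).2
    rw [w2, KP_zero, sub_zero] at this
    exact this
  have ew : w = jj v0 mv0 := by
    apply vl_inj
    show vl w = (v0, 0)
    rw [← w2]
  have v0z : ∀ n, n ∉ Ico M M' → v0 n = 0 := by
    intro n hn
    rw [hv0, hw, vl_cut]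
    simp only [indicator_of_notMem hn]
  set r := t - w with hr
  have er : t = w + r := by rw [hr]; abel
  have er2 : r = cut (Iio M) t + cut (Ici M') t + cut (Ico M M') (kk d md) := by
    have := cut3 hMM t
    rw [hr, hw, map_sub]
    nth_rewrite 1 [this]
    abel
  have nr : ‖r‖ ≤ err := by
    rw [er2]
    have h1 := norm_add_le (cut (Iio M) t + cut (Ici M') t) (cut (Ico M M') (kk d md))
    have h2 := norm_add_le (cut (Iio M) t) (cut (Ici M') t)
    have : err = 300 * η := by rw [hη]; ring
    linarith
  have nt : c / 6 ≤ ‖t‖ := by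
    have := hT (Nn p)
    have h2 : c * (1 / 6) ≤ c * ‖Nn p‖ := by gcongr
    linarith
  set l := l2norm v0 with hl'
  have hll : l0 ≤ l := by
    have h1 := norm_add_le w r
    rw [← er] at h1
    have h2 := norm_le_zn w
    have h3 : zn w = l := by rw [ew, zn_jj]
    rw [h3] at h2
    rw [hl0]; linarith
  have hlp : 0 < l := by linarith
  set v : RSeq := l⁻¹ • v0 with hv
  have mv : memL2 v := mv0.smul _
  have nv : l2norm v = 1 := by
    rw [hv, l2norm_smul, abs_of_pos (inv_pos.2 hlp), inv_mul_cancel₀ hlp.ne']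
  have jv : jj v mv = l⁻¹ • w := by rw [ew, ← jj_smul]
  refine ⟨M', p, kk v mv, hMM, ⟨?_, hp.2⟩, (isBlk_kk mv ?_ nv).mono hK, ?_⟩
  · apply cut_of_zero
    intro n hn
    exact zero_of_cut hp.1 (fun h => hn (by simp at h ⊢; omega))
  · intro n hn
    simp [hv, v0z n hn]
  have eneg : ∀ u z, om ((-T) u) z = - om (T u) z := fun u z => om_neg_left _ _
  rw [eneg, val_expand, Nn_kk, ← ht, ← hL]
  have hA : |om (T p) (kk v mv)| ≤ a := by
    refine (om_T_le T p (kk v mv)).trans ?_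
    rw [zn_kk, nv, mul_one, ha]
    gcongr
  have hB1 : l - err ≤ om t (kk v mv) := by
    have h1 : om t (kk v mv) = om w (kk v mv) + om r (kk v mv) := by
      rw [← om_add_left, ← er]
    have h2 := om_le_norm r (kk v mv)
    rw [zn_kk, nv, mul_one] at h2
    have h3 : om w (kk v mv) = l := by
      rw [ew, om_jj_kk]
      have : ∀ n, v0 n * v n = l⁻¹ * (v0 n ^ 2) := fun n => by
        simp [hv]; ring
      simp_rw [this]
      rw [tsum_mul_left, ← l2norm_sq, ← hl']
      field_simp
    have := (abs_le.1 h2).1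
    linarith
  have hTp : ‖T p‖ ≤ ‖T‖ * (4 * (K + 1)) := by
    refine (T.le_opNorm p).trans ?_
    have := norm_le_zn p
    gcongr
    linarith
  have hB2 : |om (T p) (jj v mv)| ≤ (κ + b * err) / l0 := by
    have h1 : om (T p) t = om (T p) w + om (T p) r := by
      rw [← om_add_right, ← er]
    have h2 : |om (T p) r| ≤ b * err := by
      refine (om_norm _ _).trans ?_
      calc 6 * ‖T p‖ * ‖r‖ ≤ 6 * (‖T‖ * (4 * (K + 1))) * err := by gcongr
        _ = b * err := by rw [hb]; ring
    have h3 : |om (T p) t| ≤ κ := by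
      rw [om_antisymm, abs_neg]; exact hpk
    have h4 : |om (T p) w| ≤ κ + b * err := by
      rw [abs_le] at h2 h3 ⊢
      constructor <;> linarith
    rw [jv, om_smul_right, abs_mul, abs_of_pos (inv_pos.2 hlp), inv_mul_eq_div]
    gcongr
    exact (abs_nonneg _).trans h4
  have hB3 : (κ + b * err) / l0 = l0 / 2 + err * (b / l0) := by
    rw [hκ]; field_simp
  have hD : |om t (jj v mv)| ≤ err := by
    have h1 : om t (jj v mv) = om w (jj v mv) + om r (jj v mv) := by
      rw [← om_add_left, ← er]
    have h2 := om_le_norm r (jj v mv)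
    rw [zn_jj, nv, mul_one] at h2
    have h3 : om w (jj v mv) = 0 := by rw [ew, om_jj_jj]
    rw [h1, h3, zero_add]
    exact h2.trans nr
  set A := om (T p) (kk v mv)
  set B1 := om t (kk v mv)
  set B2 := om (T p) (jj v mv)
  set D := om t (jj v mv)
  have hB : l0 / 4 ≤ B1 + B2 := by
    have := (abs_le.1 hB2).1
    nlinarith
  have hLB : L * (l0 / 4) ≤ L * (B1 + B2) := by gcongr
  have hLD : L ^ 2 * D ≤ 1 := by
    calc L ^ 2 * D ≤ L ^ 2 * err := by
          gcongr; exact (le_abs_self _).trans hD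
      _ ≤ 1 := he3
  have := (abs_le.1 hA).2
  linarith

lemma cut_mono {A B : Set ℕ} (h : A ⊆ B) {u : Z} (hu : cut A u = u) : cut B u = u :=
  cut_of_zero fun _ hn => zero_of_cut hu fun h' => hn (h h')

lemma jj_add_kk (u : Z) : u = jj ((vl u).1 - KP (vl u).2) (vl_mem u).2 + kk (vl u).2 (vl_mem u).1 := by
  apply vl_inj
  rw [map_add]
  show vl u = ((vl u).1 - KP (vl u).2, (0 : RSeq)) + (KP (vl u).2, (vl u).2)
  ext n <;> simp

lemma om_sub_left (u v w : Z) : om (u - v) w = om u w - om v w := by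
  simp only [← OM_apply, map_sub]; rfl

lemma lemH_aux (T : Z →L[ℝ] Z) {κ θ c' : ℝ} (hθ : 0 < θ) (hθ2 : θ ≤ 1 / 2)
    (h1 : 16 * c' ≤ κ * θ) (h2 : 32 * c' + 192 * ‖T‖ ^ 2 * θ ≤ κ) (N M' : ℕ)
    (u : Z) (hu : cut (Ico N M') u = u) (zu : zn u = 1)
    (hw : ∀ w, cut (Ico N M') w = w → |om (T u) (T w)| ≤ 16 * c' * zn w) :
    ∃ p, isBlk (1 / θ) (Ico N M') p ∧ |om (T (Nn p)) (T p)| ≤ κ := by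
  set x := (vl u).2 with hx
  set h := (vl u).1 - KP x with hh
  have mx : memL2 x := (vl_mem u).1
  have mh : memL2 h := (vl_mem u).2
  have xz : ∀ n, n ∉ Ico N M' → x n = 0 := fun n hn => (zero_of_cut hu hn).2
  have hz : ∀ n, n ∉ Ico N M' → h n = 0 := fun n hn => by
    rw [hh, Pi.sub_apply, (zero_of_cut hu hn).1]
    simp [KP, xz n hn]
  have hsum : l2norm h + l2norm x = 1 := zu
  set ρ := l2norm x with hρ
  set σ := l2norm h with hσ
  have hρ0 : 0 ≤ ρ := l2norm_nonneg _
  have hσ0 : 0 ≤ σ := l2norm_nonneg _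
  rcases le_or_gt θ ρ with hc | hc
  · have hρp : 0 < ρ := by linarith
    have e2 : (vl (ρ⁻¹ • u)).2 = ρ⁻¹ • x := by rw [map_smul]; rfl
    have e1 : (vl (ρ⁻¹ • u)).1 = ρ⁻¹ • (vl u).1 := by rw [map_smul]; rfl
    have n1 : l2norm (ρ⁻¹ • x) = 1 := by
      rw [l2norm_smul, abs_of_pos (inv_pos.2 hρp), ← hρ, inv_mul_cancel₀ hρp.ne']
    refine ⟨ρ⁻¹ • u, ⟨by rw [map_smul, hu], by rw [e2, n1], ?_⟩, ?_⟩
    · rw [e1, e2, KP_smul, ← smul_sub, ← hh, l2norm_smul, abs_of_pos (inv_pos.2 hρp), ← hσ,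
        inv_mul_eq_div]
      gcongr
      linarith
    · have zN : zn (Nn (ρ⁻¹ • u)) = 1 := by
        rw [Nn_apply, zn_jj, e2, n1]
      have b := hw (Nn (ρ⁻¹ • u)) (by
        rw [Nn_apply]
        exact cut_jj _ (fun n hn => by rw [e2]; simp [xz n hn]))
      rw [zN, mul_one] at b
      rw [map_smul T ρ⁻¹ u, om_smul_right, om_antisymm, abs_mul, abs_neg,
        abs_of_pos (inv_pos.2 hρp), inv_mul_eq_div, div_le_iff₀ hρp]
      have hκ : 0 ≤ κ := by
        have := (abs_nonneg _).trans b
        by_contra hk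
        push Not at hk
        nlinarith
      nlinarith
  · have hσ2 : 1 / 2 ≤ σ := by linarith
    have hσp : 0 < σ := by linarith
    set y := σ⁻¹ • h with hy
    have my : memL2 y := mh.smul _
    have ny : l2norm y = 1 := by
      rw [hy, l2norm_smul, abs_of_pos (inv_pos.2 hσp), ← hσ, inv_mul_cancel₀ hσp.ne']
    have yz : ∀ n, n ∉ Ico N M' → y n = 0 := fun n hn => by simp [hy, hz n hn]
    refine ⟨kk y my, (isBlk_kk my yz ny).mono (by positivity), ?_⟩
    have eN : jj y my = σ⁻¹ • (u - kk x mx) := by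
      rw [jj_smul σ⁻¹ mh]
      congr 1
      rw [eq_sub_iff_add_eq]
      exact (jj_add_kk u).symm
    have b1 := hw (kk y my) (cut_kk my yz)
    rw [zn_kk, ny, mul_one] at b1
    have b2 : |om (T (kk x mx)) (T (kk y my))| ≤ 96 * ‖T‖ ^ 2 * θ := by
      have t1 := (T.le_opNorm (kk x mx))
      have t2 := (T.le_opNorm (kk y my))
      have t3 := norm_le_zn (kk x mx)
      have t4 := norm_le_zn (kk y my)
      rw [zn_kk, ← hρ] at t3
      rw [zn_kk, ny] at t4
      refine (om_norm _ _).trans ?_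
      calc 6 * ‖T (kk x mx)‖ * ‖T (kk y my)‖
          ≤ 6 * (‖T‖ * ‖kk x mx‖) * (‖T‖ * ‖kk y my‖) := by gcongr
        _ ≤ 6 * (‖T‖ * (4 * θ)) * (‖T‖ * (4 * 1)) := by gcongr; linarith
        _ = _ := by ring
    rw [Nn_kk, eN, map_smul, om_smul_left, map_sub, om_sub_left, abs_mul,
      abs_of_pos (inv_pos.2 hσp), inv_mul_eq_div, div_le_iff₀ hσp]
    have b3 := abs_sub (om (T u) (T (kk y my))) (om (T (kk x mx)) (T (kk y my)))
    have b4 : |om (T u) (T (kk y my)) - om (T (kk x mx)) (T (kk y my))| ≤ κ / 2 := by linarith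
    have : 0 ≤ κ := by linarith [(abs_nonneg _).trans b4]
    nlinarith

lemma lemH (T : Z →L[ℝ] Z) {c : ℝ} (hc : 0 < c) (hT : ∀ u, c * ‖u‖ ≤ ‖T u‖) :
    ∃ N : ℕ, ∃ c' > 0, ∀ u, cut (Ici N) u = u →
      c' * ‖u‖ ≤ ‖(OM (T u)).comp (T.comp (cut (Ici N)))‖ := by
  by_contra hcon
  push Not at hcon
  set κ := (c / 48) ^ 2 / 2 with hκ
  have hκ0 : 0 < κ := by positivity
  obtain ⟨θ, hθ, hθ2, hθ3⟩ : ∃ θ : ℝ, 0 < θ ∧ θ ≤ 1 / 2 ∧ 192 * ‖T‖ ^ 2 * θ ≤ κ / 2 := by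
    refine ⟨min (1 / 2) (κ / 2 / (192 * ‖T‖ ^ 2 + 1)), by positivity, min_le_left _ _, ?_⟩
    have h := min_le_right (1 / 2) (κ / 2 / (192 * ‖T‖ ^ 2 + 1))
    calc _ ≤ 192 * ‖T‖ ^ 2 * (κ / 2 / (192 * ‖T‖ ^ 2 + 1)) := by gcongr
      _ = κ / 2 * (192 * ‖T‖ ^ 2 / (192 * ‖T‖ ^ 2 + 1)) := by ring
      _ ≤ κ / 2 * 1 := by
        gcongr
        rw [div_le_one (by positivity)]; linarith
      _ = _ := by ring
  set c' := κ * θ / 64 with hc'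
  have hc'0 : 0 < c' := by positivity
  refine lemF T hc hT (K := 1 / θ) (by positivity) hκ fun N => ?_
  obtain ⟨u, hu, hlt⟩ := hcon N c' hc'0
  have cont : Continuous fun z : Z => c' * ‖z‖ - ‖(OM (T z)).comp (T.comp (cut (Ici N)))‖ := by
    have h1 : Continuous fun z : Z => (OM (T z)).comp (T.comp (cut (Ici N))) :=
      (((ContinuousLinearMap.compL ℝ Z Z ℝ).flip (T.comp (cut (Ici N)))).comp
        (OM.comp T)).continuous
    exact (continuous_const.mul continuous_norm).sub h1.norm
  have ev := ((cont.tendsto u).comp (cut_init u)).eventually (lt_mem_nhds (sub_pos.2 hlt))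
  obtain ⟨M', hM'⟩ := ev.exists
  simp only [Function.comp_apply] at hM'
  set z := cut (Iio M') u with hz
  have hzc : cut (Ico N M') z = z := by
    apply cut_of_zero
    intro n hn
    rw [hz, vl_cut]
    by_cases h : n < M'
    · have := zero_of_cut hu (n := n) (by simp at hn ⊢; omega)
      simp [this.1, this.2, indicator]
    · simp [indicator, h]
  have hz0 : 0 < zn z := by
    rcases (zn_nonneg z).eq_or_lt with h | h
    · have := zn_eq_zero h.symm
      rw [this] at hM'
      simp at hM'
    · exact h
  refine ⟨M', lemH_aux T hθ hθ2 (c' := c') ?_ ?_ N M' ((zn z)⁻¹ • z) ?_ ?_ ?_⟩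
  · rw [hc']; nlinarith [mul_pos hκ0 hθ]
  · rw [hc']; nlinarith [mul_pos hκ0 hθ]
  · rw [map_smul, hzc]
  · rw [zn_smul, abs_of_pos (inv_pos.2 hz0), inv_mul_cancel₀ hz0.ne']
  · intro w hw
    have hw' : cut (Ici N) w = w := cut_mono (fun n hn => hn.1) hw
    have b1 := ((OM (T z)).comp (T.comp (cut (Ici N)))).le_opNorm w
    have e : ((OM (T z)).comp (T.comp (cut (Ici N)))) w = om (T z) (T w) := by
      show om (T z) (T (cut (Ici N) w)) = _
      rw [hw']
    rw [e, Real.norm_eq_abs] at b1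
    rw [map_smul, om_smul_left, abs_mul, abs_of_pos (inv_pos.2 hz0), inv_mul_eq_div,
      div_le_iff₀ hz0]
    have b2 := norm_le_zn z
    have b3 := norm_le_zn w
    have b4 := zn_nonneg w
    calc |om (T z) (T w)| ≤ _ := b1
      _ ≤ (c' * (4 * zn z)) * (4 * zn w) := by
        gcongr
        have : c' * ‖z‖ ≤ c' * (4 * zn z) := by gcongr
        linarith
      _ = _ := by ring

theorem left_inverse (T : Z →L[ℝ] Z) {c : ℝ} (hc : 0 < c) (hT : ∀ u, c * ‖u‖ ≤ ‖T u‖) :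
    ∃ L : Z →L[ℝ] Z, ∀ u, L (T u) = u := by
  obtain ⟨N, c', hc', h⟩ := lemH T hc hT
  let S : Set Z := Set.image e1 (Iio N) ∪ Set.image e2 (Iio N)
  have hS : S.Finite := ((finite_Iio N).image _).union ((finite_Iio N).image _)
  have : FiniteDimensional ℝ (Submodule.span ℝ S) := FiniteDimensional.span_of_finite ℝ hS
  refine abs_left_inverse OM OM_anti OM_surj (c0 := 1 / 4) (by norm_num)
    (fun u => by linarith [OM_lower u]) T hc hT (cut (Ici N)) (fun u => by rw [cut_cut, inter_self])
    (fun u v => om_cut _ u v) (Submodule.span ℝ S) (fun u => ?_) hc' h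
  have e : u - cut (Ici N) u = cut (Iio N) u := by
    have := cut_add_compl (Iio N) u
    rw [compl_Iio] at this
    exact (eq_sub_of_add_eq this).symm
  rw [e, cut_eq_sum]
  apply Submodule.sum_mem
  intro n hn
  have hn' : n ∈ Iio N := by simpa using hn
  apply Submodule.add_mem <;> apply Submodule.smul_mem <;> apply Submodule.subset_span
  · exact Or.inl ⟨n, hn', rfl⟩
  · exact Or.inr ⟨n, hn', rfl⟩

theorem main (T : (RSeq × RSeq) →ₗ[ℝ] (RSeq × RSeq))
    (hb : BoundedOnZ2 T)
    (hlow : ∃ c > (0 : ℝ), ∀ u : RSeq × RSeq, memZ2 u → c * Z2norm u ≤ Z2norm (T u)) :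
    ∃ P : (RSeq × RSeq) →ₗ[ℝ] (RSeq × RSeq),
      BoundedOnZ2 P ∧
      (∀ u : RSeq × RSeq, memZ2 u → P (P u) = P u) ∧
      {v : RSeq × RSeq | ∃ u : RSeq × RSeq, memZ2 u ∧ v = P u} =
        {v : RSeq × RSeq | ∃ u : RSeq × RSeq, memZ2 u ∧ v = T u} := by
  obtain ⟨hm, C, hC⟩ := hb
  obtain ⟨c, hc, hlow⟩ := hlow
  let TL : Z →ₗ[ℝ] Z := T.restrict (p := Zsub) (q := Zsub) (fun u hu => hm u hu)
  let TZ : Z →L[ℝ] Z := mkZ TL C (fun u => hC _ (vl_mem u))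
  have vT : ∀ u, vl (TZ u) = T (vl u) := fun u => rfl
  obtain ⟨L, hL⟩ := left_inverse TZ (c := c / 24) (by positivity) (fun u => by
    have h1 : c * zn u ≤ zn (TZ u) := hlow _ (vl_mem u)
    have h2 := zn_le_norm (TZ u)
    have h3 := norm_le_zn u
    have h4 : c * ‖u‖ ≤ c * (4 * zn u) := by gcongr
    linarith)
  let g : Zsub →ₗ[ℝ] (RSeq × RSeq) := (vl.comp (TZ.comp L).toLinearMap : Z →ₗ[ℝ] RSeq × RSeq)
  obtain ⟨P, hP⟩ := LinearMap.exists_extend g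
  have hPv : ∀ u : Z, P (vl u) = vl (TZ (L u)) := fun u => LinearMap.congr_fun hP u
  have hPm : ∀ u (hu : memZ2 u), P u = vl (TZ (L (mk u hu))) := fun u hu => hPv (mk u hu)
  refine ⟨P, ⟨fun u hu => ?_, 24 * ‖TZ.comp L‖, fun u hu => ?_⟩, fun u hu => ?_, ?_⟩
  · rw [hPm u hu]; exact vl_mem _
  · rw [hPm u hu]
    have h1 := zn_le_norm (TZ (L (mk u hu)))
    have h2 := (TZ.comp L).le_opNorm (mk u hu)
    have h3 := norm_le_zn (mk u hu)
    have h4 : ‖TZ.comp L‖ * ‖mk u hu‖ ≤ ‖TZ.comp L‖ * (4 * zn (mk u hu)) := by gcongr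
    rw [ContinuousLinearMap.comp_apply] at h2
    show zn (TZ (L (mk u hu))) ≤ 24 * ‖TZ.comp L‖ * zn (mk u hu)
    linarith
  · rw [hPm u hu, hPv, hL]
  · ext v
    constructor
    · rintro ⟨u, hu, rfl⟩
      exact ⟨vl (L (mk u hu)), vl_mem _, by rw [hPm u hu, vT]⟩
    · rintro ⟨u, hu, rfl⟩
      refine ⟨T u, hm u hu, ?_⟩
      have : T u = vl (TZ (mk u hu)) := rfl
      rw [this, hPv, hL]

end KPZ

/-- Every copy of Z₂ in Z₂ is complemented: if a linear map T is bounded on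
Z₂ and bounded below on Z₂, then its range on Z₂ is the range of a bounded linear
projection on Z₂. -/
theorem stmt_18 (T : (RSeq × RSeq) →ₗ[ℝ] (RSeq × RSeq))
    (hb : BoundedOnZ2 T)
    (hlow : ∃ c > (0 : ℝ), ∀ u : RSeq × RSeq, memZ2 u → c * Z2norm u ≤ Z2norm (T u)) :
    ∃ P : (RSeq × RSeq) →ₗ[ℝ] (RSeq × RSeq),
      BoundedOnZ2 P ∧
      (∀ u : RSeq × RSeq, memZ2 u → P (P u) = P u) ∧
      {v : RSeq × RSeq | ∃ u : RSeq × RSeq, memZ2 u ∧ v = P u} =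
        {v : RSeq × RSeq | ∃ u : RSeq × RSeq, memZ2 u ∧ v = T u} := by
  exact KPZ.main T hb hlow
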